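/- arXiv:1608.06094 — 3 statements merged into one kernel-verified Lean document; each statement's English description precedes it below -/
import Mathlib

section
/- Let A = (A₁,...,A_m) be any m-tuple of n×n complex Hermitian matrices and L : (H_n)^m → ℝ² any linear map. Then the point L((tr A₁/n)·I_n, ..., (tr A_m/n)·I_n) belongs to the L-numerical range W_L(A). -/
open Matrix

/-- The `L`-numerical range of an `m`-tuple of `n × n` complex matrices:
`W_L(A) = { L(U*A₁U, ..., U*A_mU) : U unitary }`. -/
noncomputable def LNumericalRange {n m l : ℕ}
    (L : (Fin m → Matrix (Fin n) (Fin n) ℂ) →ₗ[ℝ] (Fin l → ℝ))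
    (A : Fin m → Matrix (Fin n) (Fin n) ℂ) : Set (Fin l → ℝ) :=
  {y | ∃ U ∈ Matrix.unitaryGroup (Fin n) ℂ, y = L fun i => Uᴴ * A i * U}


lemma aux_const {X : Type*} [TopologicalSpace X] [PreconnectedSpace X] (a : X → ℂ)
    (ha : Continuous a) (h : ∀ x y, Complex.exp (a x) = Complex.exp (a y)) (x y : X) :
    a x = a y :=
  Complex.isCoveringMap_exp.const_of_comp ha (fun x y => Subtype.ext (h x y)) x y

lemma aux_lift {E : Type*} [NormedAddCommGroup E] [NormedSpace ℝ E] (F : E → ℂ)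
    (hF : Continuous F) (h0 : ∀ x, F x ≠ 0) :
    ∃ g : E → ℂ, Continuous g ∧ ∀ x, Complex.exp (g x) = F x := by
  obtain ⟨g, ⟨-, hg⟩, -⟩ := Complex.isCoveringMap_exp.existsUnique_continuousMap_lifts
    (⟨fun x => ⟨F x, h0 x⟩, by fun_prop⟩ : C(E, {z : ℂ // z ≠ 0})) 0 (Complex.log (F 0))
    (Subtype.ext (Complex.exp_log (h0 0)))
  exact ⟨g, g.continuous, fun x => congrArg Subtype.val (congrFun hg x)⟩

/-- Two logarithms of the same function along a connected space differ by a constant. -/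
lemma aux_diff {X : Type*} [TopologicalSpace X] [PreconnectedSpace X] (a b : X → ℂ)
    (ha : Continuous a) (hb : Continuous b) (h : ∀ x, Complex.exp (a x) = Complex.exp (b x))
    (x y : X) : a x - a y = b x - b y := by
  have := aux_const (fun x => a x - b x) (ha.sub hb)
    (fun x y => by simp only [Complex.exp_sub, h]; simp) x y
  linear_combination this

/-- odd symmetry gives nonzero winding. -/
lemma aux_odd (g : ℝ → ℂ) (hg : Continuous g)
    (h : ∀ t, Complex.exp (g (t + Real.pi)) = - Complex.exp (g t)) : g (2 * Real.pi) ≠ g 0 := by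
  have h1 : ∀ t s, g (t + Real.pi) - g t = g (s + Real.pi) - g s := by
    apply aux_const (fun t => g (t + Real.pi) - g t) (by fun_prop)
    intro x y
    simp only [Complex.exp_sub, h]
    field_simp [Complex.exp_ne_zero]
  have h2 := h1 0 Real.pi
  rw [zero_add, ← two_mul] at h2
  intro h3
  have h4 : g Real.pi = g 0 := by rw [h3] at h2; linear_combination h2 / 2
  have h5 := h 0
  rw [zero_add, h4] at h5
  exact Complex.exp_ne_zero (g 0) (by linear_combination h5 / 2)

noncomputable def auxD {n : ℕ} (P : Matrix (Fin n) (Fin n) ℂ) (z : ℂ) : Matrix (Fin n) (Fin n) ℂ :=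
  1 + (z - 1) • P

noncomputable def auxV {n : ℕ} (j k : Fin n) (t : ℝ) : Fin n → ℂ :=
  fun i => if i = j then (Real.cos t : ℂ) else if i = k then (Real.sin t : ℂ) else 0

noncomputable def auxP {n : ℕ} (j k : Fin n) (t : ℝ) : Matrix (Fin n) (Fin n) ℂ :=
  vecMulVec (auxV j k t) (auxV j k t)

lemma auxV_star {n : ℕ} (j k : Fin n) (t : ℝ) : star (auxV j k t) = auxV j k t := by
  ext i
  simp only [auxV, Pi.star_apply]
  split_ifs <;> simp [Complex.conj_ofReal, -Complex.ofReal_cos, -Complex.ofReal_sin]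

lemma auxV_dot {n : ℕ} (j k : Fin n) (hjk : j ≠ k) (t : ℝ) :
    auxV j k t ⬝ᵥ auxV j k t = 1 := by
  have : ∀ i, auxV j k t i * auxV j k t i = (if i = j then (Real.cos t : ℂ)^2 else 0) +
      (if i = k then (Real.sin t : ℂ)^2 else 0) := by
    intro i
    simp only [auxV]
    by_cases h : i = j
    · subst h; simp [hjk, sq]
    · by_cases h' : i = k
      · subst h'; simp [h, sq]
      · simp [h, h']
  simp only [dotProduct, this, Finset.sum_add_distrib, Finset.sum_ite_eq', Finset.mem_univ, if_true]
  exact_mod_cast Real.cos_sq_add_sin_sq t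

lemma auxP_herm {n : ℕ} (j k : Fin n) (t : ℝ) : (auxP j k t)ᴴ = auxP j k t := by
  rw [auxP, conjTranspose_vecMulVec, auxV_star]

lemma auxP_sq {n : ℕ} (j k : Fin n) (hjk : j ≠ k) (t : ℝ) :
    auxP j k t * auxP j k t = auxP j k t := by
  rw [auxP, vecMulVec_mul_vecMulVec, auxV_dot j k hjk, one_smul]

lemma auxD_mem {n : ℕ} (P : Matrix (Fin n) (Fin n) ℂ) (h1 : Pᴴ = P) (h2 : P * P = P)
    (z : ℂ) (hz : star z * z = 1) : auxD P z ∈ unitaryGroup (Fin n) ℂ := by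
  rw [mem_unitaryGroup_iff', star_eq_conjTranspose, auxD]
  simp only [conjTranspose_add, conjTranspose_one, conjTranspose_smul, h1, mul_add, add_mul, one_mul,
    mul_one, smul_mul_smul_comm, h2, star_sub, star_one]
  rw [add_assoc, ← add_smul, ← add_smul]
  have : (star z - 1 + ((z - 1) + (star z - 1) * (z - 1))) = 0 := by linear_combination hz
  rw [add_eq_left]
  convert zero_smul ℂ P using 2

lemma aux_unit (t : ℝ) : star (Complex.exp (t * Complex.I)) * Complex.exp (t * Complex.I) = 1 := by
  rw [Complex.star_def, ← Complex.exp_conj, ← Complex.exp_add]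
  simp

lemma aux_exp_add (t : ℝ) : Complex.exp (((t + 2 * Real.pi : ℝ) : ℂ) * Complex.I) =
    Complex.exp (t * Complex.I) := by
  push_cast
  rw [add_mul, Complex.exp_add, Complex.exp_two_pi_mul_I, mul_one]

noncomputable def auxT {n : ℕ} (θ : Fin n → ℝ) : Matrix (Fin n) (Fin n) ℂ :=
  diagonal fun i => Complex.exp (θ i * Complex.I)

lemma auxT_mem {n : ℕ} (θ : Fin n → ℝ) : auxT θ ∈ unitaryGroup (Fin n) ℂ := by
  rw [mem_unitaryGroup_iff', star_eq_conjTranspose, auxT, diagonal_conjTranspose, diagonal_mul_diagonal]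
  rw [← diagonal_one]
  congr 1
  ext i
  exact aux_unit _

lemma auxD_zero {n : ℕ} (j k : Fin n) (s : ℝ) :
    auxD (auxP j k 0) (Complex.exp (s * Complex.I)) = auxT (s • Pi.single j 1) := by
  ext a b
  simp only [auxD, auxP, auxT, Matrix.add_apply, Matrix.smul_apply, vecMulVec_apply, auxV, one_apply,
    diagonal_apply, Pi.smul_apply, Pi.single_apply]
  by_cases h : a = b <;> by_cases h2 : a = j <;> by_cases h3 : b = j <;> simp_all

lemma auxD_half {n : ℕ} (j k : Fin n) (hjk : j ≠ k) (s : ℝ) :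
    auxD (auxP j k (Real.pi / 2)) (Complex.exp (s * Complex.I)) = auxT (s • Pi.single k 1) := by
  ext a b
  simp only [auxD, auxP, auxT, Matrix.add_apply, Matrix.smul_apply, vecMulVec_apply, auxV, one_apply,
    diagonal_apply, Pi.smul_apply, Pi.single_apply, Real.cos_pi_div_two, Real.sin_pi_div_two]
  by_cases h : a = b <;> by_cases h2 : a = k <;> by_cases h3 : b = k <;> simp_all [hjk.symm]

lemma auxP_cont {n : ℕ} (j k : Fin n) : Continuous (auxP j k) := by
  apply continuous_matrix
  intro a b
  simp only [auxP, vecMulVec_apply, auxV]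
  split_ifs <;> fun_prop

lemma auxT_cont {n : ℕ} : Continuous (auxT (n := n)) := by
  unfold auxT
  apply Continuous.matrix_diagonal
  fun_prop

/-- The winding number of an invariant non-vanishing function along the loops is zero. -/
lemma aux_wind {n : ℕ} (F : Matrix (Fin n) (Fin n) ℂ → ℂ) (hF : Continuous F)
    (h0 : ∀ U ∈ unitaryGroup (Fin n) ℂ, F U ≠ 0)
    (hinv : ∀ (U : Matrix (Fin n) (Fin n) ℂ) (z : ℂ), star z * z = 1 → F (z • U) = F U)
    (j k : Fin n) (hjk : j ≠ k) (t : ℝ) (u : ℝ → ℂ) (hu : Continuous u)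
    (hu' : ∀ s : ℝ, Complex.exp (u s) = F (auxD (auxP j k t) (Complex.exp (s * Complex.I)))) :
    u (2 * Real.pi) = u 0 := by
  obtain ⟨g, hg, hg'⟩ := aux_lift (fun θ : Fin n → ℝ => F (auxT θ)) (hF.comp auxT_cont)
    (fun θ => h0 _ (auxT_mem θ))
  -- homotopy
  have key : ∀ j k : Fin n, j ≠ k → ∃ h : ℝ × ℝ → ℂ, Continuous h ∧
      (∀ x, Complex.exp (h x) = F (auxD (auxP j k x.2) (Complex.exp (x.1 * Complex.I)))) ∧
      ∀ t s, h (2 * Real.pi, t) - h (0, t) = h (2 * Real.pi, s) - h (0, s) := by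
    intro j k hjk
    obtain ⟨h, hh, hh'⟩ := aux_lift
      (fun x : ℝ × ℝ => F (auxD (auxP j k x.2) (Complex.exp (x.1 * Complex.I))))
      (by
        apply hF.comp
        unfold auxD
        have := (auxP_cont j k).comp (continuous_snd (X := ℝ) (Y := ℝ))
        simp only [Function.comp_def] at this
        fun_prop)
      (fun x => h0 _ (auxD_mem _ (auxP_herm _ _ _) (auxP_sq _ _ hjk _) _ (aux_unit _)))
    refine ⟨h, hh, hh', ?_⟩
    apply aux_const (fun t => h (2 * Real.pi, t) - h (0, t)) (by fun_prop)
    intro x y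
    have e : ∀ t, Complex.exp (h (2 * Real.pi, t)) = Complex.exp (h (0, t)) := by
      intro t
      rw [hh', hh']
      have := aux_exp_add 0
      rw [zero_add] at this
      simp only [this]
    simp only [Complex.exp_sub, e]
    simp
  let δ : Fin n → ℂ := fun j => g ((2 * Real.pi) • Pi.single j 1) - g 0
  have d0 : ∀ j k : Fin n, j ≠ k → ∀ h : ℝ × ℝ → ℂ, Continuous h →
      (∀ x, Complex.exp (h x) = F (auxD (auxP j k x.2) (Complex.exp (x.1 * Complex.I)))) →
      h (2 * Real.pi, 0) - h (0, 0) = δ j ∧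
      h (2 * Real.pi, Real.pi / 2) - h (0, Real.pi / 2) = δ k := by
    intro j k hjk h hh hh'
    constructor
    · rw [aux_diff (fun s : ℝ => h (s, 0)) (fun s : ℝ => g (s • Pi.single j 1)) (by fun_prop)
        (by fun_prop) (fun s => by rw [hh', hg', auxD_zero]) (2 * Real.pi) 0]
      simp [δ]
    · rw [aux_diff (fun s : ℝ => h (s, Real.pi / 2)) (fun s : ℝ => g (s • Pi.single k 1))
        (by fun_prop)
        (by fun_prop) (fun s => by rw [hh', hg', auxD_half _ _ hjk]) (2 * Real.pi) 0]
      simp [δ]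
  have deq : ∀ j k, δ j = δ k := by
    intro j k
    by_cases hjk : j = k
    · rw [hjk]
    obtain ⟨h, hh, hh', hc⟩ := key j k hjk
    rw [← (d0 j k hjk h hh hh').1, ← (d0 j k hjk h hh hh').2]
    exact hc _ _
  have per : ∀ j (θ : Fin n → ℝ), g (θ + (2 * Real.pi) • Pi.single j 1) - g θ = δ j := by
    intro j θ
    have := aux_const (fun θ => g (θ + (2 * Real.pi) • Pi.single j 1) - g θ) (by fun_prop) (by
      have e : ∀ θ, Complex.exp (g (θ + (2 * Real.pi) • Pi.single j 1)) = Complex.exp (g θ) := by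
        intro θ
        rw [hg', hg']
        congr 1
        unfold auxT
        congr 1
        funext i
        by_cases hi : i = j
        · subst hi
          simp only [Pi.add_apply, Pi.smul_apply, Pi.single_eq_same, smul_eq_mul, mul_one]
          exact aux_exp_add _
        · simp [hi]
      intro x y
      simp only [Complex.exp_sub, e]
      simp) θ 0
    simpa [δ] using this
  have tele : ∀ s : Finset (Fin n), g (∑ j ∈ s, (2 * Real.pi) • Pi.single j 1) - g 0 =
      ∑ j ∈ s, δ j := by
    intro s
    induction s using Finset.induction_on with
    | empty => simp
    | insert a s ha ih =>
      rw [Finset.sum_insert ha, Finset.sum_insert ha, ← ih, add_comm _ (∑ j ∈ s, _),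
        ← per a (∑ j ∈ s, (2 * Real.pi) • Pi.single j 1)]
      ring
  have diag : ∀ x y : ℝ, g (fun _ => x) = g (fun _ => y) := by
    apply aux_const (fun x : ℝ => g (fun _ => x)) (by fun_prop)
    have e : ∀ x : ℝ, Complex.exp (g (fun _ => x)) = F 1 := by
      intro x
      rw [hg', ← hinv 1 _ (aux_unit x)]
      congr 1
      ext a b
      simp [auxT, diagonal_apply, one_apply]
    intro x y
    rw [e, e]
  have hd : δ j = 0 := by
    have h1 := tele Finset.univ
    have h2 : (∑ j : Fin n, (2 * Real.pi) • (Pi.single j 1 : Fin n → ℝ)) = fun _ => 2 * Real.pi := by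
      ext i
      simp [Finset.sum_apply, Pi.single_apply]
    rw [h2, diag _ 0, Finset.sum_congr rfl (fun i _ => deq i j)] at h1
    have h3 : (fun _ => 0 : Fin n → ℝ) = 0 := rfl
    rw [h3, sub_self, Finset.sum_const, nsmul_eq_mul] at h1
    rcases mul_eq_zero.mp h1.symm with h | h
    · have : 0 < n := j.pos
      simp at h
      omega
    · exact h
  obtain ⟨h, hh, hh', hc⟩ := key j k hjk
  have h1 := aux_diff u (fun s : ℝ => h (s, t)) hu (by fun_prop)
    (fun s => by rw [hu', hh']) (2 * Real.pi) 0
  rw [hc t 0, (d0 j k hjk h hh hh').1, hd] at h1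
  exact sub_eq_zero.mp h1

lemma aux_F_cont {n m : ℕ} (L : (Fin m → Matrix (Fin n) (Fin n) ℂ) →ₗ[ℝ] (Fin 2 → ℝ))
    (A : Fin m → Matrix (Fin n) (Fin n) ℂ) :
    Continuous fun U : Matrix (Fin n) (Fin n) ℂ => L fun i => Uᴴ * A i * U := by
  have : Continuous L := L.continuous_of_finiteDimensional
  apply this.comp
  fun_prop

/-- The pinching lemma. -/
lemma aux_pinch {n m : ℕ} (L : (Fin m → Matrix (Fin n) (Fin n) ℂ) →ₗ[ℝ] (Fin 2 → ℝ))
    (A : Fin m → Matrix (Fin n) (Fin n) ℂ) (j k : Fin n) (hjk : j ≠ k) (t : ℝ) :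
    (L fun i => (1 - auxP j k t) * A i * (1 - auxP j k t) + auxP j k t * A i * auxP j k t) ∈
      LNumericalRange L A := by
  by_contra hcon
  set P := auxP j k t with hP
  set c := L fun i => (1 - P) * A i * (1 - P) + P * A i * P with hc
  let f : Matrix (Fin n) (Fin n) ℂ → (Fin 2 → ℝ) := fun U => L fun i => Uᴴ * A i * U
  have hf : Continuous f := aux_F_cont L A
  let F : Matrix (Fin n) (Fin n) ℂ → ℂ := fun U =>
    ((f U 0 - c 0 : ℝ) : ℂ) + ((f U 1 - c 1 : ℝ) : ℂ) * Complex.I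
  have hFc : Continuous F := by fun_prop
  have h0 : ∀ U ∈ unitaryGroup (Fin n) ℂ, F U ≠ 0 := by
    intro U hU h
    apply hcon
    refine ⟨U, hU, ?_⟩
    have h1 := congrArg Complex.re h
    have h2 := congrArg Complex.im h
    simp [F] at h1 h2
    funext i
    fin_cases i
    · simp only [f] at h1; simp; linarith
    · simp only [f] at h2; simp; linarith
  have hinv : ∀ (U : Matrix (Fin n) (Fin n) ℂ) (z : ℂ), star z * z = 1 → F (z • U) = F U := by
    intro U z hz
    have : f (z • U) = f U := by
      simp only [f]
      congr 1
      funext i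
      rw [conjTranspose_smul, smul_mul_assoc, smul_mul_smul_comm, hz, one_smul]
    simp only [F, this]
  have hmem : ∀ s : ℝ, auxD P (Complex.exp (s * Complex.I)) ∈ unitaryGroup (Fin n) ℂ := fun s =>
    auxD_mem _ (auxP_herm _ _ _) (auxP_sq _ _ hjk _) _ (aux_unit _)
  obtain ⟨u, hu, hu'⟩ := aux_lift (fun s : ℝ => F (auxD P (Complex.exp (s * Complex.I))))
    (by apply hFc.comp; unfold auxD; fun_prop) (fun s => h0 _ (hmem s))
  refine aux_odd u hu ?_ (aux_wind F hFc h0 hinv j k hjk t u hu hu')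
  intro s
  rw [hu', hu']
  have e : Complex.exp (((s + Real.pi : ℝ) : ℂ) * Complex.I) = - Complex.exp (s * Complex.I) := by
    push_cast
    rw [add_mul, Complex.exp_add, Complex.exp_pi_mul_I]
    ring
  rw [e]
  have hz := aux_unit s
  set z := Complex.exp (s * Complex.I)
  have hsum : f (auxD P (-z)) + f (auxD P z) = c + c := by
    simp only [f, hc, ← map_add]
    congr 1
    funext i
    have hPh : Pᴴ = P := auxP_herm _ _ _
    simp only [Pi.add_apply]
    have d1 : ∀ w : ℂ, auxD P w = (1 - P) + w • P := by
      intro w; simp only [auxD, sub_smul, one_smul]; abel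
    have d2 : ∀ w : ℂ, (auxD P w)ᴴ = (1 - P) + star w • P := by
      intro w; simp [d1, hPh]
    rw [d2, d2, d1, d1]
    generalize (1 - P) = Q
    have hz' : z * star z = 1 := by rw [mul_comm]; exact hz
    simp only [add_mul, mul_add, smul_mul_assoc, mul_smul_comm, smul_add, smul_neg, smul_smul,
      star_neg, neg_smul, neg_mul, mul_neg, neg_neg, hz', one_smul]
    abel
  have s0 := congrFun hsum 0
  have s1 := congrFun hsum 1
  simp only [Pi.add_apply] at s0 s1
  have r0 : f (auxD P (-z)) 0 - c 0 = -(f (auxD P z) 0 - c 0) := by linarith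
  have r1 : f (auxD P (-z)) 1 - c 1 = -(f (auxD P z) 1 - c 1) := by linarith
  simp only [F, r0, r1]
  push_cast
  ring

lemma aux_compact (n : ℕ) : IsCompact {U : Matrix (Fin n) (Fin n) ℂ | U ∈ unitaryGroup (Fin n) ℂ} := by
  have hK : IsCompact {U : Matrix (Fin n) (Fin n) ℂ |
      ∀ i, U i ∈ {r : Fin n → ℂ | ∀ k, r k ∈ Metric.closedBall (0 : ℂ) 1}} :=
    isCompact_pi_infinite fun i => isCompact_pi_infinite fun k => isCompact_closedBall _ _
  refine hK.of_isClosed_subset ?_ ?_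
  · have : {U : Matrix (Fin n) (Fin n) ℂ | U ∈ unitaryGroup (Fin n) ℂ} = {U | Uᴴ * U = 1} := by
      ext U
      exact mem_unitaryGroup_iff'
    rw [this]
    exact isClosed_eq (by fun_prop) continuous_const
  · intro U hU i k
    simpa using entry_norm_bound_of_unitary hU i k

lemma aux_range_compact {n m : ℕ} (L : (Fin m → Matrix (Fin n) (Fin n) ℂ) →ₗ[ℝ] (Fin 2 → ℝ))
    (A : Fin m → Matrix (Fin n) (Fin n) ℂ) : IsCompact (LNumericalRange L A) := by
  have := (aux_compact n).image (aux_F_cont L A)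
  convert this using 1
  ext y
  simp only [LNumericalRange, Set.mem_ofPred_eq, Set.mem_image]
  exact ⟨fun ⟨U, h, e⟩ => ⟨U, h, e.symm⟩, fun ⟨U, h, e⟩ => ⟨U, h, e.symm⟩⟩

/-- The set of tuples whose image lies in every range of `A`. -/
def auxS {n m : ℕ} (A : Fin m → Matrix (Fin n) (Fin n) ℂ) :
    Set (Fin m → Matrix (Fin n) (Fin n) ℂ) :=
  {B | (∀ L : (Fin m → Matrix (Fin n) (Fin n) ℂ) →ₗ[ℝ] (Fin 2 → ℝ), L B ∈ LNumericalRange L A) ∧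
    ∀ i, trace (B i) = trace (A i)}

lemma auxS_self {n m : ℕ} (A : Fin m → Matrix (Fin n) (Fin n) ℂ) : A ∈ auxS A :=
  ⟨fun L => ⟨1, one_mem _, by simp⟩, fun _ => rfl⟩

noncomputable def auxEntry {n m : ℕ} (i : Fin m) (j k : Fin n) :
    (Fin m → Matrix (Fin n) (Fin n) ℂ) →ₗ[ℝ] (Fin 2 → ℝ) where
  toFun B := ![(B i j k).re, (B i j k).im]
  map_add' B C := by ext a; fin_cases a <;> simp
  map_smul' c B := by ext a; fin_cases a <;> simp

lemma auxS_compact {n m : ℕ} (A : Fin m → Matrix (Fin n) (Fin n) ℂ) : IsCompact (auxS A) := by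
  let K : Fin m → Fin n → Fin n → Set ℂ := fun i j k =>
    (fun U : Matrix (Fin n) (Fin n) ℂ => (Uᴴ * A i * U) j k) ''
      {U : Matrix (Fin n) (Fin n) ℂ | U ∈ unitaryGroup (Fin n) ℂ}
  have hK : ∀ i j k, IsCompact (K i j k) := fun i j k =>
    (aux_compact n).image (Continuous.matrix_elem (by fun_prop) j k)
  have hK' : IsCompact {B : Fin m → Matrix (Fin n) (Fin n) ℂ |
      ∀ i, B i ∈ {X : Matrix (Fin n) (Fin n) ℂ | ∀ j, X j ∈ {r : Fin n → ℂ | ∀ k, r k ∈ K i j k}}} :=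
    isCompact_pi_infinite fun i => isCompact_pi_infinite fun j => isCompact_pi_infinite fun k =>
      hK i j k
  refine hK'.of_isClosed_subset ?_ ?_
  · have h1 : IsClosed (⋂ L : (Fin m → Matrix (Fin n) (Fin n) ℂ) →ₗ[ℝ] (Fin 2 → ℝ),
        L ⁻¹' LNumericalRange L A) := isClosed_iInter fun L =>
      (aux_range_compact L A).isClosed.preimage L.continuous_of_finiteDimensional
    have h2 : IsClosed (⋂ i : Fin m, {B : Fin m → Matrix (Fin n) (Fin n) ℂ |
        trace (B i) = trace (A i)}) := isClosed_iInter fun i =>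
      isClosed_eq (continuous_apply i).matrix_trace continuous_const
    convert h1.inter h2 using 1
    ext B
    simp [auxS]
  · intro B hB i j k
    obtain ⟨U, hU, e⟩ := hB.1 (auxEntry i j k)
    refine ⟨U, hU, ?_⟩
    have e0 := congrFun e 0
    have e1 := congrFun e 1
    simp only [auxEntry, LinearMap.coe_mk, AddHom.coe_mk, cons_val_zero, cons_val_one] at e0 e1
    exact Complex.ext e0.symm e1.symm

noncomputable def auxConj {n m : ℕ} (U : Matrix (Fin n) (Fin n) ℂ) :
    (Fin m → Matrix (Fin n) (Fin n) ℂ) →ₗ[ℝ] (Fin m → Matrix (Fin n) (Fin n) ℂ) where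
  toFun B := fun i => Uᴴ * B i * U
  map_add' B C := by funext i; simp [mul_add, add_mul]
  map_smul' c B := by funext i; simp

lemma auxS_pinch {n m : ℕ} (A B : Fin m → Matrix (Fin n) (Fin n) ℂ) (hB : B ∈ auxS A)
    (j k : Fin n) (hjk : j ≠ k) (t : ℝ) :
    (fun i => (1 - auxP j k t) * B i * (1 - auxP j k t) + auxP j k t * B i * auxP j k t) ∈
      auxS A := by
  constructor
  · intro L
    obtain ⟨U, hU, e⟩ := aux_pinch L B j k hjk t
    rw [e]
    obtain ⟨V, hV, e'⟩ := hB.1 (L ∘ₗ auxConj U)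
    refine ⟨V * U, mul_mem hV hU, ?_⟩
    simp only [LinearMap.comp_apply, auxConj, LinearMap.coe_mk, AddHom.coe_mk] at e'
    rw [e']
    simp only [conjTranspose_mul, Matrix.mul_assoc]
  · intro i
    rw [← hB.2 i]
    have hP := auxP_sq j k hjk t
    generalize auxP j k t = P at *
    have h1 : trace (P * B i * P) = trace (P * B i) := by
      rw [trace_mul_comm, ← Matrix.mul_assoc, hP]
    have h2 : trace (B i * P) = trace (P * B i) := trace_mul_comm _ _
    simp only [sub_mul, mul_sub, one_mul, mul_one, trace_add, trace_sub, h1, h2]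
    ring

noncomputable def auxPhi {n m : ℕ} (B : Fin m → Matrix (Fin n) (Fin n) ℂ) : ℝ :=
  ∑ i, (trace ((B i)ᴴ * B i)).re

open scoped ComplexOrder in
lemma aux_nonneg {n : ℕ} (X : Matrix (Fin n) (Fin n) ℂ) : 0 ≤ (trace (Xᴴ * X)).re := by
  have := (posSemidef_conjTranspose_mul_self X).trace_nonneg
  exact (Complex.le_def.mp this).1

open scoped ComplexOrder in
lemma aux_zero {n : ℕ} (X : Matrix (Fin n) (Fin n) ℂ) (h : (trace (Xᴴ * X)).re = 0) : X = 0 := by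
  have := (posSemidef_conjTranspose_mul_self X).trace_nonneg
  apply trace_conjTranspose_mul_self_eq_zero_iff.mp
  exact Complex.ext h (Complex.le_def.mp this).2.symm

lemma aux_pyth {n : ℕ} (X P : Matrix (Fin n) (Fin n) ℂ) (h1 : Pᴴ = P) (h2 : P * P = P) :
    trace (Xᴴ * X) = trace (((1 - P) * X * (1 - P) + P * X * P)ᴴ * ((1 - P) * X * (1 - P) + P * X * P))
      + trace (((1 - P) * X * P + P * X * (1 - P))ᴴ * ((1 - P) * X * P + P * X * (1 - P))) := by
  obtain ⟨Q, hQ⟩ : ∃ Q, Q = 1 - P := ⟨_, rfl⟩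
  have q1 : Qᴴ = Q := by simp [hQ, h1]
  have q2 : P * Q = 0 := by simp [hQ, mul_sub, h2]
  have q3 : Q * P = 0 := by simp [hQ, sub_mul, h2]
  have hX : X = (Q * X * Q + P * X * P) + (Q * X * P + P * X * Q) := by
    simp only [hQ, sub_mul, mul_sub, one_mul, mul_one]; abel
  rw [← hQ]
  have c1 : trace ((Q * X * Q + P * X * P)ᴴ * (Q * X * P + P * X * Q)) = 0 := by
    simp only [conjTranspose_add, conjTranspose_mul, h1, q1]
    generalize Xᴴ = Y
    simp only [add_mul, mul_add, trace_add]
    have a1 : trace (Q * (Y * Q) * (Q * X * P)) = 0 := by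
      rw [← Matrix.mul_assoc, trace_mul_comm]
      simp only [← Matrix.mul_assoc, q2]; simp
    have a2 : trace (P * (Y * P) * (P * X * Q)) = 0 := by
      rw [← Matrix.mul_assoc, trace_mul_comm]
      simp only [← Matrix.mul_assoc, q3]; simp
    have a3 : Q * (Y * Q) * (P * X * Q) = 0 := by
      rw [show Q * (Y * Q) * (P * X * Q) = Q * Y * (Q * P) * X * Q by simp only [Matrix.mul_assoc], q3]
      simp
    have a4 : P * (Y * P) * (Q * X * P) = 0 := by
      rw [show P * (Y * P) * (Q * X * P) = P * Y * (P * Q) * X * P by simp only [Matrix.mul_assoc], q2]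
      simp
    simp [a1, a2, a3, a4]
  have c2 : trace ((Q * X * P + P * X * Q)ᴴ * (Q * X * Q + P * X * P)) = 0 := by
    have := congrArg star c1
    rw [← trace_conjTranspose, conjTranspose_mul, conjTranspose_conjTranspose, star_zero] at this
    exact this
  generalize Q * X * Q + P * X * P = C at *
  generalize Q * X * P + P * X * Q = E at *
  rw [hX, conjTranspose_add, add_mul, mul_add, mul_add, trace_add, trace_add, trace_add, c1, c2]
  ring

/-- For any tuple of Hermitian matrices `A` and any linear `L : H_n^m → ℝ²`, the point
`L((tr A₁/n)·Iₙ, ..., (tr A_m/n)·Iₙ)` belongs to `W_L(A)`. -/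
theorem stmt14 {n m : ℕ} (A : Fin m → Matrix (Fin n) (Fin n) ℂ)
    (hA : ∀ i, (A i).IsHermitian)
    (L : (Fin m → Matrix (Fin n) (Fin n) ℂ) →ₗ[ℝ] (Fin 2 → ℝ)) :
    (L fun i => (Matrix.trace (A i) / n) • (1 : Matrix (Fin n) (Fin n) ℂ)) ∈
      LNumericalRange L A := by
  obtain ⟨B, hB, hmin⟩ := (auxS_compact A).exists_isMinOn ⟨A, auxS_self A⟩
    (f := auxPhi) (Continuous.continuousOn (by
      unfold auxPhi
      refine continuous_finsetSum _ fun i _ => Complex.continuous_re.comp ?_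
      apply Continuous.matrix_trace
      fun_prop))
  have comm : ∀ (j k : Fin n) (_ : j ≠ k) (t : ℝ) (i : Fin m),
      B i * auxP j k t = auxP j k t * B i := by
    intro j k hjk t
    have h := hmin (auxS_pinch A B hB j k hjk t)
    have hPh := auxP_herm j k t
    have hP := auxP_sq j k hjk t
    generalize auxP j k t = P at *
    simp only [Set.mem_ofPred_eq, auxPhi] at h
    have hs : ∑ i, (trace (((1 - P) * B i * P + P * B i * (1 - P))ᴴ *
        ((1 - P) * B i * P + P * B i * (1 - P)))).re = 0 := by
      apply le_antisymm _ (Finset.sum_nonneg fun i _ => aux_nonneg _)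
      rw [Finset.sum_congr rfl (fun i _ => congrArg Complex.re (aux_pyth (B i) P hPh hP))] at h
      simp only [Complex.add_re, Finset.sum_add_distrib] at h
      linarith
    intro i
    have hz := aux_zero _ ((Finset.sum_eq_zero_iff_of_nonneg fun i _ => aux_nonneg _).mp hs i
      (Finset.mem_univ i))
    have r := congrArg (· * P) hz
    have l := congrArg (P * ·) hz
    have q2 : P * (1 - P) = 0 := by simp [mul_sub, hP]
    have q3 : (1 - P) * P = 0 := by simp [sub_mul, hP]
    simp only [add_mul, Matrix.mul_assoc, hP, q3, mul_zero, add_zero, zero_mul] at r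
    simp only [mul_add, ← Matrix.mul_assoc, hP, q2, mul_zero, zero_add, zero_mul] at l
    simp only [sub_mul, one_mul, mul_sub, mul_one] at r l
    rw [sub_eq_zero.mp r, sub_eq_zero.mp l, Matrix.mul_assoc]
  have off : ∀ i a b, a ≠ b → B i a b = 0 := by
    intro i a b hab
    have := congrFun (congrFun (comm b a hab.symm 0 i) a) b
    rw [auxP, mul_vecMulVec, vecMulVec_mul] at this
    simp only [vecMulVec_apply] at this
    have v : auxV b a 0 = Pi.single b 1 := by
      ext c; simp [auxV, Pi.single_apply]
    simpa [v, hab] using this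
  have dg : ∀ i a b, B i a a = B i b b := by
    intro i a b
    by_cases hab : a = b
    · rw [hab]
    have h := congrFun (congrFun (comm a b hab (Real.pi / 4) i) a) b
    rw [auxP, mul_vecMulVec, vecMulVec_mul] at h
    simp only [vecMulVec_apply] at h
    rw [show (B i *ᵥ auxV a b (Real.pi / 4)) a = B i a a * auxV a b (Real.pi / 4) a by
      rw [mulVec, dotProduct]
      exact Finset.sum_eq_single a (fun c _ hc => by rw [off i a c hc.symm, zero_mul]) (by simp),
      show (auxV a b (Real.pi / 4) ᵥ* B i) b = auxV a b (Real.pi / 4) b * B i b b by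
      rw [vecMul, dotProduct]
      exact Finset.sum_eq_single b (fun c _ hc => by rw [off i c b hc, mul_zero]) (by simp)] at h
    have va : auxV a b (Real.pi / 4) a ≠ 0 := by
      simp only [auxV, if_true, Real.cos_pi_div_four]
      exact_mod_cast (by positivity : (√2 / 2 : ℝ) ≠ 0)
    have vb : auxV a b (Real.pi / 4) b ≠ 0 := by
      simp only [auxV, if_neg (Ne.symm hab), if_true, Real.sin_pi_div_four]
      exact_mod_cast (by positivity : (√2 / 2 : ℝ) ≠ 0)
    apply mul_left_cancel₀ (mul_ne_zero va vb)
    linear_combination h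
  have hfin : (fun i => (Matrix.trace (A i) / n) • (1 : Matrix (Fin n) (Fin n) ℂ)) = B := by
    funext i
    ext a b
    rw [Matrix.smul_apply, one_apply]
    by_cases hab : a = b
    · subst hab
      have hn : (n : ℂ) ≠ 0 := by
        have := a.pos
        exact_mod_cast this.ne'
      have ht : trace (B i) = n * B i a a := by
        have : ∀ c, (B i).diag c = B i a a := fun c => dg i c a
        simp only [trace, this]
        simp
      rw [← hB.2 i, ht, if_pos rfl, smul_eq_mul]
      field_simp
    · simp [hab, off i a b hab]
  rw [hfin]
  exact hB.1 L
end

section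
/- Let n ≥ 2 and let A = (A₁,...,A_m) be an m-tuple of n×n complex Hermitian matrices that are simultaneously unitarily diagonalizable, i.e., there exists a unitary U ∈ U_n such that U*A_iU is diagonal for all i = 1,...,m. Then for every linear map L : (H_n)^m → ℝ², the L-numerical range W_L(A) is star-shaped with star-center L((tr A₁/n)·I_n, ..., (tr A_m/n)·I_n). -/
open Matrix

section Trotter
open Filter Topology

lemma aux_pow_sub {R : Type*} [NormedRing R] (a b : R) (ha : ∀ j : ℕ, ‖a ^ j‖ ≤ 1)
    (hb : ‖b‖ ≤ 1) (k : ℕ) : ‖a ^ k - b ^ k‖ ≤ k * ‖a - b‖ := by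
  induction k with
  | zero => simp
  | succ k ih =>
    have h : a ^ (k+1) - b ^ (k+1) = a ^ k * (a - b) + (a ^ k - b ^ k) * b := by
      rw [pow_succ, pow_succ]; noncomm_ring
    rw [h]
    have h1 : ‖a ^ k * (a - b)‖ ≤ 1 * ‖a - b‖ :=
      (norm_mul_le _ _).trans (mul_le_mul_of_nonneg_right (ha k) (norm_nonneg _))
    have h2 : ‖(a ^ k - b ^ k) * b‖ ≤ ‖a ^ k - b ^ k‖ * 1 :=
      (norm_mul_le _ _).trans (mul_le_mul_of_nonneg_left hb (norm_nonneg _))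
    have h3 := norm_add_le (a ^ k * (a - b)) ((a ^ k - b ^ k) * b)
    push_cast
    linarith

lemma aux_deriv {R : Type*} [NormedRing R] [NormedAlgebra ℝ R] (l : List R) :
    HasDerivAt (fun ε : ℝ => (l.map (fun x => 1 + ε • x)).prod) l.sum 0 := by
  induction l with
  | nil => simpa using hasDerivAt_const (0:ℝ) (1:R)
  | cons x l ih =>
    have h1 : HasDerivAt (fun ε : ℝ => 1 + ε • x) x 0 := by
      simpa using ((hasDerivAt_id (0:ℝ)).smul_const x).const_add 1
    have h := h1.mul ih
    simp only [List.map_cons, List.prod_cons, List.sum_cons]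
    have e : x + l.sum = x * (l.map (fun x => 1 + (0:ℝ) • x)).prod + (1 + (0:ℝ) • x) * l.sum := by
      simp
    rw [e]
    exact h

lemma aux_trotter {R : Type*} [NormedRing R] [NormedAlgebra ℝ R] (l : List R) (c : ℝ)
    (h1 : ∀ᶠ ε in 𝓝[≥] (0:ℝ), ∀ j : ℕ, ‖((l.map (fun x => 1 + ε • x)).prod) ^ j‖ ≤ 1)
    (h2 : ∀ᶠ ε in 𝓝[≥] (0:ℝ), ‖1 + ε • l.sum‖ ≤ 1) (hc : 0 ≤ c) :
    Tendsto (fun k : ℕ => ((l.map (fun x => 1 + (c / k) • x)).prod) ^ k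
      - (1 + (c / k) • l.sum) ^ k) atTop (𝓝 0) := by
  have ht : Tendsto (fun k : ℕ => c / (k:ℝ)) atTop (𝓝[≥] 0) := by
    refine tendsto_nhdsWithin_iff.2 ⟨tendsto_const_div_atTop_nhds_zero_nat c, ?_⟩
    exact Eventually.of_forall fun k => div_nonneg hc (Nat.cast_nonneg k)
  have ho := (hasDerivAt_iff_isLittleO_nhds_zero.1 (aux_deriv l))
  have ho2 := ho.comp_tendsto (ht.mono_right nhdsWithin_le_nhds)
  rw [Metric.tendsto_atTop']
  intro δ hδ
  have hb := ho2.def (c := δ / (2 * (c + 1))) (by positivity)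
  have key : ∀ᶠ k : ℕ in atTop, dist (((l.map (fun x => 1 + (c / k) • x)).prod) ^ k
      - (1 + (c / k) • l.sum) ^ k) 0 < δ := by
    filter_upwards [hb, ht.eventually h1, ht.eventually h2, eventually_gt_atTop 0] with k k0 k1 k2 k3
    rw [dist_zero_right]
    refine (aux_pow_sub _ _ k1 k2 k).trans_lt ?_
    have hk : (0:ℝ) < k := by exact_mod_cast k3
    have e : ‖(l.map (fun x => 1 + (c / (k:ℝ)) • x)).prod - (1 + (c / (k:ℝ)) • l.sum)‖ ≤
      δ / (2 * (c + 1)) * (c / k) := by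
      simp only [Function.comp_apply, zero_add, zero_smul, add_zero, Real.norm_eq_abs] at k0
      rw [abs_of_nonneg (div_nonneg hc hk.le)] at k0
      have h0 : (l.map (fun x : R => (1 : R))).prod = 1 := by simp
      rw [h0] at k0
      rwa [sub_sub] at k0
    calc _ ≤ k * (δ / (2 * (c + 1)) * (c / k)) := by gcongr
      _ = δ * (c / (2 * (c + 1))) := by field_simp
      _ < δ * 1 := by
        gcongr
        rw [div_lt_one (by positivity)]; linarith
      _ = δ := mul_one _
  obtain ⟨N, hN⟩ := eventually_atTop.1 key
  exact ⟨N, fun k hk => hN k hk.le⟩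

end Trotter

section Stoch
open Filter Topology
attribute [local instance] Matrix.linftyOpNormedRing Matrix.linftyOpNormedAlgebra

/-- generator of a transposition -/
def genMat {n : ℕ} (pq : Fin n × Fin n) : Matrix (Fin n) (Fin n) ℝ :=
  (Equiv.swap pq.1 pq.2).permMatrix ℝ - 1

/-- averaging matrix -/
noncomputable def avgMat (n : ℕ) : Matrix (Fin n) (Fin n) ℝ := Matrix.of fun _ _ => (1 / n : ℝ)

lemma norm_le_one_of_rowStochastic {n : ℕ} {M : Matrix (Fin n) (Fin n) ℝ}
    (hM : M ∈ rowStochastic ℝ (Fin n)) : ‖M‖ ≤ 1 := by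
  rw [Matrix.linfty_opNorm_def]
  have : (Finset.univ.sup fun i => ∑ j, ‖M i j‖₊) ≤ (1 : NNReal) := by
    refine Finset.sup_le fun i _ => ?_
    rw [← NNReal.coe_le_coe]
    push_cast
    rw [← sum_row_of_mem_rowStochastic hM i]
    refine Finset.sum_le_sum fun j _ => ?_
    rw [Real.norm_of_nonneg (nonneg_of_mem_rowStochastic hM)]
  exact_mod_cast this

lemma gen_rowStochastic {n : ℕ} (pq : Fin n × Fin n) {ε : ℝ} (h0 : 0 ≤ ε) (h1 : ε ≤ 1) :
    1 + ε • genMat pq ∈ rowStochastic ℝ (Fin n) := by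
  have h : 1 + ε • genMat pq = (1 - ε) • (1 : Matrix (Fin n) (Fin n) ℝ)
      + ε • (Equiv.swap pq.1 pq.2).permMatrix ℝ := by
    unfold genMat; module
  rw [h]
  exact convex_rowStochastic (one_mem _) permMatrix_mem_rowStochastic (by linarith) h0 (by ring)

lemma avg_rowStochastic {n : ℕ} (hn : 2 ≤ n) : avgMat n ∈ rowStochastic ℝ (Fin n) := by
  rw [mem_rowStochastic_iff_sum]
  have : (n:ℝ) ≠ 0 := by positivity
  refine ⟨fun i j => by simp [avgMat], fun i => by simp [avgMat, this]⟩

lemma genMat_apply {n : ℕ} (p q i j : Fin n) : genMat (p, q) i j =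
    - (((if i = p then 1 else 0) - (if i = q then 1 else 0)) *
       ((if j = p then 1 else 0) - (if j = q then 1 else 0)) : ℝ) := by
  simp only [genMat, Matrix.sub_apply, Equiv.Perm.permMatrix, PEquiv.toMatrix_apply, Matrix.one_apply,
    Equiv.toPEquiv_apply, Equiv.swap_apply_def, Option.mem_some_iff]
  by_cases h1 : i = p <;> by_cases h2 : i = q <;> by_cases h3 : j = p <;> by_cases h4 : j = q <;>
   by_cases h5 : i = j <;> by_cases h6 : p = q <;> 
   simp_all [eq_comm]

lemma gen_sum {n : ℕ} (hn : 2 ≤ n) : ((Finset.univ : Finset (Fin n × Fin n)).toList.map genMat).sum =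
    (2 * n : ℝ) • (avgMat n - 1) := by
  have : (n:ℝ) ≠ 0 := by positivity
  rw [Finset.sum_map_toList]
  ext i j
  rw [Matrix.sum_apply, Fintype.sum_prod_type]
  simp only [genMat_apply, sub_mul, mul_sub, Finset.sum_neg_distrib, Finset.sum_sub_distrib]
  by_cases h : i = j
  · subst h
    simp [avgMat, Finset.sum_ite_eq]
    field_simp
    ring
  · simp [avgMat, Finset.sum_ite_eq, h]
    field_simp
    ring

lemma avg_sq {n : ℕ} (hn : 2 ≤ n) : avgMat n * avgMat n = avgMat n := by
  have : (n:ℝ) ≠ 0 := by positivity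
  ext i j
  simp [avgMat, Matrix.mul_apply, this]

lemma avg_pow {n : ℕ} (hn : 2 ≤ n) (t : ℝ) (k : ℕ) :
    (1 + t • (avgMat n - 1)) ^ k = (1 - t) ^ k • (1 : Matrix (Fin n) (Fin n) ℝ)
      + (1 - (1 - t) ^ k) • avgMat n := by
  induction k with
  | zero => simp
  | succ k ih =>
    rw [pow_succ, ih]
    have h : (1 + t • (avgMat n - 1)) = (1 - t) • (1 : Matrix (Fin n) (Fin n) ℝ) + t • avgMat n := by
      module
    rw [h]
    simp only [add_mul, mul_add, smul_mul_assoc, mul_smul_comm, one_mul, mul_one, avg_sq hn]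
    module

/-- the closed monoid argument -/
lemma mem_of_closed {n : ℕ} (hn : 2 ≤ n) (S : Submonoid (Matrix (Fin n) (Fin n) ℝ))
    (hS : IsClosed (S : Set (Matrix (Fin n) (Fin n) ℝ)))
    (hT : ∀ pq : Fin n × Fin n, ∀ ε : ℝ, 0 ≤ ε → ε ≤ 1 → 1 + ε • genMat pq ∈ S)
    (α : ℝ) (h0 : 0 ≤ α) (h1 : α ≤ 1) : α • (1 : Matrix (Fin n) (Fin n) ℝ) + (1 - α) • avgMat n ∈ S := by
  have hpos : ∀ β : ℝ, 0 < β → β ≤ 1 →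
      β • (1 : Matrix (Fin n) (Fin n) ℝ) + (1 - β) • avgMat n ∈ S := by
    intro β hb0 hb1
    have hn0 : (0:ℝ) < n := by positivity
    set c : ℝ := (- Real.log β) / (2 * n) with hc
    have hc0 : 0 ≤ c := div_nonneg (by have := Real.log_nonpos hb0.le hb1; linarith) (by positivity)
    set l := ((Finset.univ : Finset (Fin n × Fin n)).toList.map genMat) with hl
    have hsmall : ∀ δ : ℝ, 0 < δ → ∀ᶠ ε in 𝓝[≥] (0:ℝ), 0 ≤ ε ∧ ε ≤ δ := by
      intro δ hδ
      filter_upwards [self_mem_nhdsWithin, nhdsWithin_le_nhds (Iic_mem_nhds hδ)] with ε ha hb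
      exact ⟨ha, hb⟩
    have hprod : ∀ (S' : Submonoid (Matrix (Fin n) (Fin n) ℝ)) (ε : ℝ),
        (∀ pq : Fin n × Fin n, 1 + ε • genMat pq ∈ S') → (l.map (fun x => 1 + ε • x)).prod ∈ S' := by
      intro S' ε h
      refine Submonoid.list_prod_mem _ ?_
      intro x hx
      simp only [hl, List.map_map, List.mem_map, Function.comp_apply] at hx
      obtain ⟨pq, -, rfl⟩ := hx
      exact h pq
    have ht := aux_trotter l c ?_ ?_ hc0
    · have he : Tendsto (fun k : ℕ => (1 + (c / k) • l.sum) ^ k) atTop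
          (𝓝 (β • (1 : Matrix (Fin n) (Fin n) ℝ) + (1 - β) • avgMat n)) := by
        have hr : Tendsto (fun k : ℕ => (1 + Real.log β / (k:ℝ)) ^ k) atTop (𝓝 β) := by
          have := Real.tendsto_one_add_div_pow_exp (Real.log β)
          rwa [Real.exp_log hb0] at this
        have h2 := (hr.smul_const (1 : Matrix (Fin n) (Fin n) ℝ)).add
          ((hr.const_sub 1).smul_const (avgMat n))
        refine h2.congr fun k => ?_
        rw [hl, gen_sum hn, smul_smul, avg_pow hn]
        have : 1 - c / k * (2 * n) = 1 + Real.log β / (k:ℝ) := by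
          rw [hc]; field_simp; ring
        rw [this]
      have h3 := ht.add he
      simp only [sub_add_cancel, zero_add] at h3
      refine hS.mem_of_tendsto h3 ?_
      have ht' : Tendsto (fun k : ℕ => c / (k:ℝ)) atTop (𝓝[≥] 0) := by
        refine tendsto_nhdsWithin_iff.2 ⟨tendsto_const_div_atTop_nhds_zero_nat c, ?_⟩
        exact Eventually.of_forall fun k => div_nonneg hc0 (Nat.cast_nonneg k)
      filter_upwards [ht'.eventually (hsmall 1 one_pos)] with k hk
      exact pow_mem (hprod S _ fun pq => hT pq _ hk.1 hk.2) k
    · filter_upwards [hsmall 1 one_pos] with ε hε j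
      exact norm_le_one_of_rowStochastic
        (pow_mem (hprod _ _ fun pq => gen_rowStochastic pq hε.1 hε.2) j)
    · filter_upwards [hsmall (1 / (2 * n)) (by positivity)] with ε hε
      refine norm_le_one_of_rowStochastic ?_
      rw [hl, gen_sum hn, smul_smul]
      have h : 1 + (ε * (2 * n)) • (avgMat n - 1) =
        (1 - ε * (2 * n)) • (1 : Matrix (Fin n) (Fin n) ℝ) + (ε * (2 * n)) • avgMat n := by
        module
      rw [h]
      have h5 : ε * (2 * n) ≤ 1 := by
        have := hε.2
        rwa [le_div_iff₀ (by positivity)] at this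
      exact convex_rowStochastic (one_mem _) (avg_rowStochastic hn) (by linarith)
        (mul_nonneg hε.1 (by positivity)) (by ring)
  rcases h0.eq_or_lt with h | h
  · subst h
    have hr : Tendsto (fun k : ℕ => 1 / ((k:ℝ) + 1)) atTop (𝓝 0) :=
      tendsto_one_div_add_atTop_nhds_zero_nat
    have h2 := (hr.smul_const (1 : Matrix (Fin n) (Fin n) ℝ)).add
          ((hr.const_sub 1).smul_const (avgMat n))
    refine hS.mem_of_tendsto h2 (Eventually.of_forall fun k => hpos _ (by positivity) ?_)
    rw [div_le_one (by positivity)]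
    have : (0:ℝ) ≤ k := Nat.cast_nonneg k
    linarith
  · exact hpos α h h1

end Stoch

section Range

/-- rank one projection -/
def outerM {n : ℕ} (v : Fin n → ℂ) : Matrix (Fin n) (Fin n) ℂ := vecMulVec (star v) v

/-- generalized range -/
def rangeW {n : ℕ} (f : Fin n → (Matrix (Fin n) (Fin n) ℂ →ₗ[ℝ] (Fin 2 → ℝ))) : Set (Fin 2 → ℝ) :=
  {y | ∃ U ∈ Matrix.unitaryGroup (Fin n) ℂ, y = ∑ j, f j (outerM (U j))}

/-- Any point of a ball segment on an axis can be moved to the sphere inside a fibre. -/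
lemma sphere_fibre (f₁ f₂ f₃ : Fin 2 → ℝ) (r : ℝ) (hr : r ^ 2 ≤ 1) :
    ∃ x y z : ℝ, x ^ 2 + y ^ 2 + z ^ 2 = 1 ∧ x • f₁ + y • f₂ + z • f₃ = r • f₃ := by
  obtain ⟨k, hk, hk0⟩ : ∃ k : Fin 3 → ℝ, k 0 • f₁ + k 1 • f₂ + k 2 • f₃ = 0 ∧ k ≠ 0 := by
    have h : ¬ LinearIndependent ℝ ![f₁, f₂, f₃] := by
      intro h
      have := h.fintype_card_le_finrank
      simp at this
    rw [Fintype.not_linearIndependent_iff] at h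
    obtain ⟨g, hg, i, hi⟩ := h
    refine ⟨g, ?_, fun h0 => hi (by rw [h0]; rfl)⟩
    simpa [Fin.sum_univ_three] using hg
  set N : ℝ := k 0 ^ 2 + k 1 ^ 2 + k 2 ^ 2 with hN
  have hNpos : 0 < N := by
    by_contra hcon
    apply hk0
    have h0 : k 0 ^ 2 = 0 := by nlinarith [sq_nonneg (k 0), sq_nonneg (k 1), sq_nonneg (k 2)]
    have h1 : k 1 ^ 2 = 0 := by nlinarith [sq_nonneg (k 0), sq_nonneg (k 1), sq_nonneg (k 2)]
    have h2 : k 2 ^ 2 = 0 := by nlinarith [sq_nonneg (k 0), sq_nonneg (k 1), sq_nonneg (k 2)]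
    ext i
    fin_cases i
    · simpa using h0
    · simpa using h1
    · simpa using h2
  obtain ⟨s, hs⟩ : ∃ s : ℝ, N * (s * s) + (2 * r * k 2) * s + (r ^ 2 - 1) = 0 := by
    refine exists_quadratic_eq_zero hNpos.ne' ⟨Real.sqrt (discrim N (2 * r * k 2) (r ^ 2 - 1)), ?_⟩
    rw [Real.mul_self_sqrt]
    unfold discrim
    nlinarith [sq_nonneg (2 * r * k 2), mul_nonneg hNpos.le (sub_nonneg.2 hr)]
  refine ⟨s * k 0, s * k 1, r + s * k 2, ?_, ?_⟩
  · rw [hN] at hs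
    linear_combination hs
  · have : (s * k 0) • f₁ + (s * k 1) • f₂ + (r + s * k 2) • f₃ =
      s • (k 0 • f₁ + k 1 • f₂ + k 2 • f₃) + r • f₃ := by module
    rw [this, hk]; simp

/-- spinor of a point on the sphere -/
lemma spinor (x y z : ℝ) (h : x ^ 2 + y ^ 2 + z ^ 2 = 1) :
    ∃ (a : ℝ) (b : ℂ), a ^ 2 = (1 + z) / 2 ∧ b * star b = (((1 - z) / 2 : ℝ) : ℂ) ∧
      (a : ℂ) * b = ((x / 2 : ℝ) : ℂ) - ((y / 2 : ℝ) : ℂ) * Complex.I := by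
  by_cases hz : z = -1
  · subst hz
    have hx : x = 0 := by nlinarith [sq_nonneg x, sq_nonneg y]
    have hy : y = 0 := by nlinarith [sq_nonneg x, sq_nonneg y]
    exact ⟨0, 1, by norm_num, by norm_num, by simp [hx, hy]⟩
  · have hz1 : 0 < (1 + z) / 2 := by
      have : -1 ≤ z := by nlinarith [sq_nonneg x, sq_nonneg y]
      have := lt_of_le_of_ne this (Ne.symm hz)
      linarith
    set a := Real.sqrt ((1 + z) / 2) with ha
    have ha0 : 0 < a := Real.sqrt_pos.2 hz1
    have ha2 : a ^ 2 = (1 + z) / 2 := Real.sq_sqrt hz1.le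
    refine ⟨a, ⟨x / (2 * a), - (y / (2 * a))⟩, ha2, ?_, ?_⟩
    · apply Complex.ext
      · simp
        field_simp
        rw [ha2]; linear_combination h
      · simp; ring
    · apply Complex.ext
      · simp; field_simp
      · simp; field_simp

lemma outer_comb {n : ℕ} (u v : Fin n → ℂ) (a : ℝ) (b : ℂ) (x y z : ℝ)
    (h1 : a ^ 2 = (1 + z) / 2) (h2 : b * star b = (((1 - z) / 2 : ℝ) : ℂ))
    (h3 : (a : ℂ) * b = ((x / 2 : ℝ) : ℂ) - ((y / 2 : ℝ) : ℂ) * Complex.I) :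
    outerM ((a:ℂ) • u + b • v) = ((1 + z) / 2 : ℝ) • outerM u + ((1 - z) / 2 : ℝ) • outerM v
      + (x / 2) • (vecMulVec (star u) v + vecMulVec (star v) u)
      + (y / 2) • (Complex.I • (vecMulVec (star v) u - vecMulVec (star u) v)) ∧
    outerM ((-star b) • u + (a:ℂ) • v) = ((1 - z) / 2 : ℝ) • outerM u + ((1 + z) / 2 : ℝ) • outerM v
      - (x / 2) • (vecMulVec (star u) v + vecMulVec (star v) u)
      - (y / 2) • (Complex.I • (vecMulVec (star v) u - vecMulVec (star u) v)) := by
  have h1' : (a:ℂ) ^ 2 = (1 + z) / 2 := by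
    have := congrArg (fun t : ℝ => (t:ℂ)) h1
    push_cast at this; exact this
  have h4 : (a : ℂ) * star b = ((x / 2 : ℝ) : ℂ) + ((y / 2 : ℝ) : ℂ) * Complex.I := by
    have := congrArg star h3
    simp only [star_mul', star_sub, RCLike.star_def, Complex.conj_ofReal, Complex.conj_I] at this
    rw [RCLike.star_def, this]; ring
  simp only [RCLike.star_def] at h2 h4
  push_cast at h2 h3 h4
  constructor
  · ext i j
    simp only [outerM, vecMulVec_apply, Matrix.add_apply, Matrix.sub_apply, Matrix.smul_apply,
      Pi.star_apply, Pi.add_apply, Pi.smul_apply, smul_eq_mul, Complex.real_smul, star_add, star_mul',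
      RCLike.star_def, Complex.conj_ofReal]
    push_cast
    linear_combination (starRingEnd ℂ (u i) * u j) * h1' + (starRingEnd ℂ (v i) * v j) * h2 +
      (starRingEnd ℂ (u i) * v j) * h3 + (starRingEnd ℂ (v i) * u j) * h4
  · ext i j
    simp only [outerM, vecMulVec_apply, Matrix.add_apply, Matrix.sub_apply, Matrix.smul_apply,
      Pi.star_apply, Pi.add_apply, Pi.smul_apply, smul_eq_mul, Complex.real_smul, star_add, star_mul',
      RCLike.star_def, Complex.conj_ofReal, star_neg, Complex.conj_conj]
    push_cast
    linear_combination (starRingEnd ℂ (v i) * v j) * h1' + (starRingEnd ℂ (u i) * u j) * h2 -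
      (starRingEnd ℂ (u i) * v j) * h3 - (starRingEnd ℂ (v i) * u j) * h4

lemma mem_unitary_rows {n : ℕ} (U : Matrix (Fin n) (Fin n) ℂ) :
    U ∈ Matrix.unitaryGroup (Fin n) ℂ ↔ ∀ i j, U i ⬝ᵥ star (U j) = if i = j then 1 else 0 := by
  rw [Matrix.mem_unitaryGroup_iff]
  constructor
  · intro h i j
    have := congrFun (congrFun h i) j
    rw [Matrix.one_apply] at this
    rw [← this]; rfl
  · intro h
    ext i j
    rw [Matrix.one_apply, ← h i j]; rfl

lemma rotate_unitary {n : ℕ} (U : Matrix (Fin n) (Fin n) ℂ) (hU : U ∈ Matrix.unitaryGroup (Fin n) ℂ)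
    (p q : Fin n) (hpq : p ≠ q) (a : ℝ) (b : ℂ) (hab : (a:ℂ) ^ 2 + b * star b = 1)
    (V : Matrix (Fin n) (Fin n) ℂ) (hVp : V p = (a:ℂ) • U p + b • U q)
    (hVq : V q = (-star b) • U p + (a:ℂ) • U q) (hV : ∀ j, j ≠ p → j ≠ q → V j = U j) :
    V ∈ Matrix.unitaryGroup (Fin n) ℂ := by
  rw [mem_unitary_rows] at hU ⊢
  simp only [RCLike.star_def] at hab
  have hqp := hpq.symm
  intro i j
  by_cases hip : i = p
  · subst hip
    by_cases hjp : j = i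
    · subst hjp
      simp [hVp, add_dotProduct, dotProduct_add, hU, hpq, hqp]
      linear_combination hab
    · by_cases hjq : j = q
      · subst hjq
        simp [hVp, hVq, add_dotProduct, dotProduct_add, hU, hpq, hqp]
        ring
      · simp [hVp, hV j hjp hjq, add_dotProduct, hU, Ne.symm hjp, Ne.symm hjq]
  · by_cases hiq : i = q
    · subst hiq
      by_cases hjp : j = p
      · subst hjp
        simp [hVp, hVq, add_dotProduct, dotProduct_add, hU, hpq, hqp]
        ring
      · by_cases hjq : j = i
        · subst hjq
          simp [hVq, add_dotProduct, dotProduct_add, hU, hpq, hqp]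
          linear_combination hab
        · simp [hVq, hV j hjp hjq, add_dotProduct, hU, Ne.symm hjp, Ne.symm hjq]
    · rw [hV i hip hiq]
      by_cases hjp : j = p
      · subst hjp
        simp [hVp, dotProduct_add, hU, hip, hiq]
      · by_cases hjq : j = q
        · subst hjq
          simp [hVq, dotProduct_add, hU, hip, hiq]
        · rw [hV j hjp hjq, hU]

lemma step_mem {n : ℕ} (f g : Fin n → (Matrix (Fin n) (Fin n) ℂ →ₗ[ℝ] (Fin 2 → ℝ)))
    (p q : Fin n) (hpq : p ≠ q) (ε : ℝ) (h0 : 0 ≤ ε) (h1 : ε ≤ 1)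
    (hg : ∀ j, j ≠ p → j ≠ q → g j = f j) (hp : g p = (1 - ε) • f p + ε • f q)
    (hq : g q = (1 - ε) • f q + ε • f p) : rangeW g ⊆ rangeW f := by
  rintro _ ⟨U, hU, rfl⟩
  set X := vecMulVec (star (U p)) (U q) + vecMulVec (star (U q)) (U p) with hX
  set Y := Complex.I • (vecMulVec (star (U q)) (U p) - vecMulVec (star (U p)) (U q)) with hY
  obtain ⟨x, y, z, hs, hfib⟩ := sphere_fibre ((f p - f q) X) ((f p - f q) Y)
    ((f p - f q) (outerM (U p) - outerM (U q))) (1 - 2 * ε) (by nlinarith)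
  obtain ⟨a, b, e1, e2, e3⟩ := spinor x y z hs
  obtain ⟨o1, o2⟩ := outer_comb (U p) (U q) a b x y z e1 e2 e3
  rw [← hX, ← hY] at o1 o2
  have hab : (a:ℂ) ^ 2 + b * star b = 1 := by
    rw [e2, ← Complex.ofReal_pow, e1, ← Complex.ofReal_add]
    norm_num
    ring
  obtain ⟨V, hVp, hVq, hV⟩ : ∃ V : Matrix (Fin n) (Fin n) ℂ, V p = (a:ℂ) • U p + b • U q ∧
      V q = (-star b) • U p + (a:ℂ) • U q ∧ ∀ j, j ≠ p → j ≠ q → V j = U j := by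
    refine ⟨Matrix.of fun j => if j = p then (a:ℂ) • U p + b • U q else if j = q then
      (-star b) • U p + (a:ℂ) • U q else U j, ?_, ?_, ?_⟩
    · exact if_pos rfl
    · exact (if_neg hpq.symm).trans (if_pos rfl)
    · intro j h1 h2
      exact (if_neg h1).trans (if_neg h2)
  refine ⟨V, rotate_unitary U hU p q hpq a b hab V hVp hVq hV, ?_⟩
  rw [← Finset.add_sum_erase _ _ (Finset.mem_univ p), ← Finset.add_sum_erase _ _
    (Finset.mem_erase.2 ⟨hpq.symm, Finset.mem_univ q⟩),
    ← Finset.add_sum_erase Finset.univ (fun j => f j _) (Finset.mem_univ p),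
    ← Finset.add_sum_erase _ (fun j => f j _)
    (Finset.mem_erase.2 ⟨hpq.symm, Finset.mem_univ q⟩), ← add_assoc, ← add_assoc]
  congr 1
  · rw [hVp, hVq, o1, o2, hp, hq]
    simp only [map_add, map_sub, map_smul, LinearMap.add_apply, LinearMap.sub_apply,
      LinearMap.smul_apply] at hfib ⊢
    ext i
    have := congrFun hfib i
    simp only [Pi.add_apply, Pi.sub_apply, Pi.smul_apply, smul_eq_mul] at this ⊢
    linear_combination (-1/2) * this
  · refine Finset.sum_congr rfl fun j hj => ?_
    simp only [Finset.mem_erase, Finset.mem_univ, and_true] at hj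
    rw [hg j hj.2 hj.1, hV j hj.2 hj.1]

/-- matrices acting on families of functionals -/
noncomputable def actM {n : ℕ} (M : Matrix (Fin n) (Fin n) ℝ)
    (f : Fin n → (Matrix (Fin n) (Fin n) ℂ →ₗ[ℝ] (Fin 2 → ℝ))) :
    Fin n → (Matrix (Fin n) (Fin n) ℂ →ₗ[ℝ] (Fin 2 → ℝ)) := fun j => ∑ k, M j k • f k

lemma actM_mul {n : ℕ} (M N : Matrix (Fin n) (Fin n) ℝ) (f) : actM (M * N) f = actM M (actM N f) := by
  funext j
  simp only [actM, Matrix.mul_apply, Finset.sum_smul, Finset.smul_sum, smul_smul]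
  exact Finset.sum_comm

lemma actM_one {n : ℕ} (f) : actM (1 : Matrix (Fin n) (Fin n) ℝ) f = f := by
  funext j
  simp [actM, Matrix.one_apply]

/-- the monoid of range-shrinking matrices -/
noncomputable def shrinkS (n : ℕ) : Submonoid (Matrix (Fin n) (Fin n) ℝ) where
  carrier := {M | ∀ f, rangeW (actM M f) ⊆ rangeW f}
  one_mem' := fun f => by rw [actM_one]
  mul_mem' := fun {M N} hM hN f => by
    rw [actM_mul]
    exact (hM _).trans (hN f)

lemma actM_gen {n : ℕ} (pq : Fin n × Fin n) (ε : ℝ) (f) (j : Fin n) :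
    actM (1 + ε • genMat pq) f j = (1 - ε) • f j + ε • f (Equiv.swap pq.1 pq.2 j) := by
  simp only [actM, genMat, Matrix.add_apply, Matrix.smul_apply, Matrix.sub_apply,
    Equiv.Perm.permMatrix, PEquiv.toMatrix_apply, Matrix.one_apply,
    Equiv.toPEquiv_apply, Option.mem_some_iff, smul_eq_mul, mul_sub, add_smul, sub_smul,
    Finset.sum_add_distrib, Finset.sum_sub_distrib]
  simp
  module

lemma gen_mem_shrink {n : ℕ} (pq : Fin n × Fin n) (ε : ℝ) (h0 : 0 ≤ ε) (h1 : ε ≤ 1) :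
    1 + ε • genMat pq ∈ shrinkS n := by
  intro f
  by_cases h : pq.1 = pq.2
  · have : actM (1 + ε • genMat pq) f = f := by
      funext j
      rw [actM_gen, h]
      simp
      module
    rw [this]
  · refine step_mem f _ pq.1 pq.2 h ε h0 h1 ?_ ?_ ?_
    · intro j hp hq
      rw [actM_gen, Equiv.swap_apply_of_ne_of_ne hp hq]
      module
    · rw [actM_gen, Equiv.swap_apply_left]
    · rw [actM_gen, Equiv.swap_apply_right]

lemma isCompact_unitary (n : ℕ) :
    IsCompact (Matrix.unitaryGroup (Fin n) ℂ : Set (Matrix (Fin n) (Fin n) ℂ)) := by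
  have hK : IsCompact (Set.univ.pi fun _ : Fin n => Set.univ.pi fun _ : Fin n =>
      Metric.closedBall (0:ℂ) 1) :=
    isCompact_univ_pi fun i => isCompact_univ_pi fun j => isCompact_closedBall 0 1
  refine IsCompact.of_isClosed_subset hK ?_ ?_
  · have : (Matrix.unitaryGroup (Fin n) ℂ : Set (Matrix (Fin n) (Fin n) ℂ)) =
        {U | U * star U = 1} := by
      ext U
      exact Matrix.mem_unitaryGroup_iff
    rw [this]
    exact isClosed_eq (by fun_prop) continuous_const
  · intro U hU i _ j _
    simpa using entry_norm_bound_of_unitary hU i j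

lemma isCompact_rangeW {n : ℕ} (f : Fin n → (Matrix (Fin n) (Fin n) ℂ →ₗ[ℝ] (Fin 2 → ℝ))) :
    IsCompact (rangeW f) := by
  have : rangeW f = (fun U : Matrix (Fin n) (Fin n) ℂ => ∑ j, f j (outerM (U j))) ''
      (Matrix.unitaryGroup (Fin n) ℂ : Set (Matrix (Fin n) (Fin n) ℂ)) := by
    ext y
    constructor
    · rintro ⟨U, hU, rfl⟩; exact ⟨U, hU, rfl⟩
    · rintro ⟨U, hU, rfl⟩; exact ⟨U, hU, rfl⟩
  rw [this]
  refine (isCompact_unitary n).image ?_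
  refine continuous_finsetSum _ fun j _ => ?_
  refine (f j).continuous_of_finiteDimensional.comp ?_
  refine continuous_matrix fun a b => ?_
  simp only [outerM, vecMulVec_apply, Pi.star_apply]
  have h (a b : Fin n) : Continuous fun U : Matrix (Fin n) (Fin n) ℂ => U a b :=
    continuous_id.matrix_elem a b
  exact (continuous_star.comp (h j a)).mul (h j b)

lemma isClosed_shrink (n : ℕ) : IsClosed (shrinkS n : Set (Matrix (Fin n) (Fin n) ℝ)) := by
  have : (shrinkS n : Set (Matrix (Fin n) (Fin n) ℝ)) =
      ⋂ f, ⋂ U : Matrix.unitaryGroup (Fin n) ℂ,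
        (fun M : Matrix (Fin n) (Fin n) ℝ => ∑ j, ∑ k, M j k • f k (outerM (U.1 j))) ⁻¹' rangeW f := by
    ext M
    simp only [Set.mem_iInter, Set.mem_preimage]
    constructor
    · intro h f U
      refine h f ⟨U.1, U.2, ?_⟩
      simp [actM]
    · rintro h f _ ⟨U, hU, rfl⟩
      have := h f ⟨U, hU⟩
      simpa [actM] using this
  rw [this]
  refine isClosed_iInter fun f => isClosed_iInter fun U =>
    (isCompact_rangeW f).isClosed.preimage ?_
  refine continuous_finsetSum _ fun j _ => continuous_finsetSum _ fun k _ => ?_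
  exact (continuous_id.matrix_elem j k).smul continuous_const

lemma conj_diag {n : ℕ} (V : Matrix (Fin n) (Fin n) ℂ) (d : Fin n → ℂ) :
    Vᴴ * diagonal d * V = ∑ j, d j • outerM (V j) := by
  ext a b
  rw [Matrix.mul_apply, Matrix.sum_apply]
  refine Finset.sum_congr rfl fun j _ => ?_
  simp [outerM, vecMulVec_apply, Matrix.mul_diagonal]
  ring

lemma sum_outer {n : ℕ} (V : Matrix (Fin n) (Fin n) ℂ) (hV : V ∈ Matrix.unitaryGroup (Fin n) ℂ) :
    ∑ j, outerM (V j) = 1 := by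
  have h := conj_diag V 1
  simp only [Pi.one_apply, one_smul] at h
  rw [← h, ← Matrix.mem_unitaryGroup_iff'.1 hV]
  have : (diagonal 1 : Matrix (Fin n) (Fin n) ℂ) = 1 := Matrix.diagonal_one
  rw [this, mul_one, star_eq_conjTranspose]

/-- functionals attached to a diagonal tuple -/
noncomputable def funcL {n m : ℕ} (L : (Fin m → Matrix (Fin n) (Fin n) ℂ) →ₗ[ℝ] (Fin 2 → ℝ))
    (d : Fin m → Fin n → ℂ) (j : Fin n) : Matrix (Fin n) (Fin n) ℂ →ₗ[ℝ] (Fin 2 → ℝ) :=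
  L ∘ₗ LinearMap.pi fun i => d i j • (LinearMap.id : Matrix (Fin n) (Fin n) ℂ →ₗ[ℝ] _)

lemma funcL_apply {n m : ℕ} (L : (Fin m → Matrix (Fin n) (Fin n) ℂ) →ₗ[ℝ] (Fin 2 → ℝ))
    (d : Fin m → Fin n → ℂ) (j : Fin n) (X) : funcL L d j X = L fun i => d i j • X := by
  simp only [funcL, LinearMap.comp_apply]
  rfl

lemma range_eq {n m : ℕ} (L : (Fin m → Matrix (Fin n) (Fin n) ℂ) →ₗ[ℝ] (Fin 2 → ℝ))
    (A : Fin m → Matrix (Fin n) (Fin n) ℂ) (d : Fin m → Fin n → ℂ)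
    (U₀ : Matrix (Fin n) (Fin n) ℂ) (hU₀ : U₀ ∈ Matrix.unitaryGroup (Fin n) ℂ)
    (hd : ∀ i, A i = U₀ * diagonal (d i) * U₀ᴴ) : LNumericalRange L A = rangeW (funcL L d) := by
  have hval : ∀ V : Matrix (Fin n) (Fin n) ℂ, ∑ j, funcL L d j (outerM (V j)) =
      L fun i => Vᴴ * diagonal (d i) * V := by
    intro V
    simp only [funcL_apply, conj_diag]
    rw [← map_sum]
    congr 1
    funext i
    simp
  have h1 : U₀ * U₀ᴴ = 1 := Matrix.mem_unitaryGroup_iff.1 hU₀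
  have h2 : U₀ᴴ * U₀ = 1 := Matrix.mem_unitaryGroup_iff'.1 hU₀
  have h3 : U₀ᴴ ∈ Matrix.unitaryGroup (Fin n) ℂ := Unitary.star_mem hU₀
  ext y
  constructor
  · rintro ⟨U, hU, rfl⟩
    refine ⟨U₀ᴴ * U, mul_mem h3 hU, ?_⟩
    rw [hval]
    congr 1
    funext i
    rw [hd, conjTranspose_mul, conjTranspose_conjTranspose]
    simp only [mul_assoc]
  · rintro ⟨V, hV, rfl⟩
    refine ⟨U₀ * V, mul_mem hU₀ hV, ?_⟩
    rw [hval]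
    congr 1
    funext i
    rw [hd, conjTranspose_mul]
    calc Vᴴ * diagonal (d i) * V = Vᴴ * 1 * diagonal (d i) * 1 * V := by simp
      _ = _ := by rw [← h2]; simp only [mul_assoc]

lemma avg_value {n : ℕ} (f : Fin n → (Matrix (Fin n) (Fin n) ℂ →ₗ[ℝ] (Fin 2 → ℝ)))
    (U : Matrix (Fin n) (Fin n) ℂ) (hU : U ∈ Matrix.unitaryGroup (Fin n) ℂ) (α : ℝ) :
    ∑ j, actM (α • (1 : Matrix (Fin n) (Fin n) ℝ) + (1 - α) • avgMat n) f j (outerM (U j)) =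
      α • ∑ j, f j (outerM (U j)) + (1 - α) • ((1 / n : ℝ) • ∑ k, f k 1) := by
  have h : ∀ j, actM (α • (1 : Matrix (Fin n) (Fin n) ℝ) + (1 - α) • avgMat n) f j =
      α • f j + (1 - α) • ((1 / n : ℝ) • ∑ k, f k) := by
    intro j
    simp only [actM, Matrix.add_apply, Matrix.smul_apply, add_smul, Finset.sum_add_distrib,
      avgMat, Matrix.of_apply, smul_assoc, ← Finset.smul_sum]
    simp [Matrix.one_apply]
  simp only [h, LinearMap.add_apply, LinearMap.smul_apply, Finset.sum_add_distrib,
    ← Finset.smul_sum, LinearMap.sum_apply]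
  rw [Finset.sum_comm]
  simp only [← map_sum, sum_outer U hU]

end Range

/-- For `n ≥ 2` and a simultaneously unitarily diagonalizable tuple of Hermitian matrices
`A`, for every linear `L : H_n^m → ℝ²` the range `W_L(A)` is star-shaped with star-center
`L((tr A₁/n)·Iₙ, ..., (tr A_m/n)·Iₙ)`. -/
theorem stmt15 {n m : ℕ} (hn : 2 ≤ n) (A : Fin m → Matrix (Fin n) (Fin n) ℂ)
    (hA : ∀ i, (A i).IsHermitian)
    (hdiag : ∃ U ∈ Matrix.unitaryGroup (Fin n) ℂ, ∀ i, (Uᴴ * A i * U).IsDiag)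
    (L : (Fin m → Matrix (Fin n) (Fin n) ℂ) →ₗ[ℝ] (Fin 2 → ℝ)) :
    (L fun i => (Matrix.trace (A i) / n) • (1 : Matrix (Fin n) (Fin n) ℂ)) ∈
      LNumericalRange L A ∧
    ∀ x ∈ LNumericalRange L A, ∀ α ∈ Set.Icc (0 : ℝ) 1,
      α • x + (1 - α) •
          (L fun i => (Matrix.trace (A i) / n) • (1 : Matrix (Fin n) (Fin n) ℂ)) ∈
        LNumericalRange L A := by
  obtain ⟨U₀, hU₀, hD⟩ := hdiag
  have h1 : U₀ * U₀ᴴ = 1 := Matrix.mem_unitaryGroup_iff.1 hU₀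
  have h2 : U₀ᴴ * U₀ = 1 := Matrix.mem_unitaryGroup_iff'.1 hU₀
  set d : Fin m → Fin n → ℂ := fun i => (U₀ᴴ * A i * U₀).diag with hd
  have hdA : ∀ i, A i = U₀ * diagonal (d i) * U₀ᴴ := by
    intro i
    rw [hd, (hD i).diagonal_diag]
    calc A i = 1 * A i * 1 := by simp
      _ = _ := by rw [← h1]; simp only [mul_assoc]
  have htr : ∀ i, Matrix.trace (A i) = ∑ j, d i j := by
    intro i
    rw [hdA i, Matrix.trace_mul_comm, ← mul_assoc, h2, one_mul, Matrix.trace_diagonal]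
  have hc : (L fun i => (Matrix.trace (A i) / n) • (1 : Matrix (Fin n) (Fin n) ℂ)) =
      (1 / n : ℝ) • ∑ k, funcL L d k 1 := by
    simp only [funcL_apply]
    rw [← map_sum, ← map_smul]
    congr 1
    funext i
    rw [htr, Pi.smul_apply, Finset.sum_apply, ← Finset.sum_smul]
    ext a b
    simp only [Matrix.smul_apply, Complex.real_smul, smul_eq_mul]
    push_cast
    ring
  rw [hc, range_eq L A d U₀ hU₀ hdA]
  have key : ∀ x ∈ rangeW (funcL L d), ∀ α ∈ Set.Icc (0 : ℝ) 1,
      α • x + (1 - α) • ((1 / n : ℝ) • ∑ k, funcL L d k 1) ∈ rangeW (funcL L d) := by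
    rintro _ ⟨U, hU, rfl⟩ α ⟨ha0, ha1⟩
    rw [← avg_value (funcL L d) U hU α]
    exact mem_of_closed hn (shrinkS n) (isClosed_shrink n) gen_mem_shrink α ha0 ha1 _ ⟨U, hU, rfl⟩
  refine ⟨?_, key⟩
  have := key _ ⟨1, one_mem _, rfl⟩ 0 ⟨le_rfl, zero_le_one⟩
  simpa using this
end

section
/- Let n > 2, let D = (D₁,...,D_m) be an m-tuple of n×n real diagonal matrices (viewed as Hermitian matrices), and let L : (H_n)^m → ℝ³ be a linear map. For each unitary U ∈ U_n, let E_L(D,U) := { L(U*T*_{θ,φ} D₁ T_{θ,φ} U, ..., U*T*_{θ,φ} D_m T_{θ,φ} U) : θ ∈ [0,π], φ ∈ [0,2π] }. If a point p ∈ ℝ³ lies in the convex hull of E_L(D,U) for some U ∈ U_n, then p ∈ W_L(D); in particular, the convex hull of E_L(D,U) is contained in W_L(D) for every U ∈ U_n. -/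
open Matrix

/-- The unitary matrix `T_{θ,φ}` whose leading 2×2 block is
`[[cos θ, sin θ · e^{iφ}], [−sin θ, cos θ · e^{iφ}]]` and which is the identity elsewhere. -/
noncomputable def Tmat (n : ℕ) (θ φ : ℝ) : Matrix (Fin n) (Fin n) ℂ :=
  Matrix.of fun i j =>
    if (i : ℕ) = 0 ∧ (j : ℕ) = 0 then (Real.cos θ : ℂ)
    else if (i : ℕ) = 0 ∧ (j : ℕ) = 1 then (Real.sin θ : ℂ) * Complex.exp (Complex.I * φ)
    else if (i : ℕ) = 1 ∧ (j : ℕ) = 0 then -(Real.sin θ : ℂ)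
    else if (i : ℕ) = 1 ∧ (j : ℕ) = 1 then (Real.cos θ : ℂ) * Complex.exp (Complex.I * φ)
    else if i = j then 1 else 0

/-- The set `E_L(D,U) = { L(U*T*_{θ,φ}D₁T_{θ,φ}U, ..., U*T*_{θ,φ}D_mT_{θ,φ}U) :
θ ∈ [0,π], φ ∈ [0,2π] }`. -/
noncomputable def Eset {n m : ℕ}
    (L : (Fin m → Matrix (Fin n) (Fin n) ℂ) →ₗ[ℝ] (Fin 3 → ℝ))
    (D : Fin m → Matrix (Fin n) (Fin n) ℂ)
    (U : Matrix (Fin n) (Fin n) ℂ) : Set (Fin 3 → ℝ) :=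
  {y | ∃ θ ∈ Set.Icc (0 : ℝ) Real.pi, ∃ φ ∈ Set.Icc (0 : ℝ) (2 * Real.pi),
    y = L fun i => Uᴴ * (Tmat n θ φ)ᴴ * D i * Tmat n θ φ * U}


theorem unitary_preconn (n : ℕ) : PreconnectedSpace (Matrix.unitaryGroup (Fin n) ℂ) := by
  open scoped Matrix.Norms.L2Operator in
  let _ : CStarAlgebra (Matrix (Fin n) (Fin n) ℂ) := {}
  suffices h : ∀ u : unitary (Matrix (Fin n) (Fin n) ℂ), Joined 1 u by
    have : PathConnectedSpace (unitary (Matrix (Fin n) (Fin n) ℂ)) :=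
      ⟨⟨1⟩, fun x y => (h x).symm.trans (h y)⟩
    exact inferInstanceAs (PreconnectedSpace (unitary (Matrix (Fin n) (Fin n) ℂ)))
  intro u
  have hfin : (spectrum ℂ (u : Matrix (Fin n) (Fin n) ℂ)).Finite := Matrix.finite_spectrum _
  obtain ⟨t, ht⟩ : ∃ t : ℝ, -Complex.exp (Complex.I * t) ∉ spectrum ℂ (u : Matrix (Fin n) (Fin n) ℂ) := by
    by_contra! hc
    have hinf : (Set.Ioo (0:ℝ) 1).Infinite := Set.Ioo_infinite one_pos
    refine hinf (Set.Finite.of_finite_image (f := fun t : ℝ => -Complex.exp (Complex.I * t))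
      (hfin.subset ?_) ?_)
    · rintro _ ⟨t, -, rfl⟩; exact hc t
    · intro a ha b hb hab
      simp only [neg_inj] at hab
      rw [Complex.exp_eq_exp_iff_exists_int] at hab
      obtain ⟨k, hk⟩ := hab
      have h2 : a = b + k * (2 * Real.pi) := by
        have := congrArg Complex.im hk
        simpa using this
      have hpi := Real.pi_gt_three
      have : k = 0 := by
        have h3 : (k:ℝ) < 1 := by
          by_contra! h; nlinarith [ha.1, ha.2, hb.1, hb.2]
        have h4 : (-1:ℝ) < k := by
          by_contra! h; nlinarith [ha.1, ha.2, hb.1, hb.2]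
        have h3' : k < 1 := by exact_mod_cast h3
        have h4' : -1 < k := by exact_mod_cast h4
        omega
      simpa [this] using h2
  have hmem : ∀ s : ℝ, Complex.exp (Complex.I * s) • (1 : Matrix (Fin n) (Fin n) ℂ) ∈ unitary (Matrix (Fin n) (Fin n) ℂ) := by
    intro s
    have : star (Complex.exp (Complex.I * s)) * Complex.exp (Complex.I * s) = 1 := by
      rw [Complex.star_def, ← Complex.exp_conj, ← Complex.exp_add]; simp
    rw [Unitary.mem_iff]
    constructor
    · rw [star_smul, smul_mul_smul_comm, this]; simp
    · rw [star_smul, smul_mul_smul_comm, mul_comm, this]; simp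
  have h1 : Joined (1 : unitary (Matrix (Fin n) (Fin n) ℂ)) ⟨_, hmem t⟩ := by
    refine ⟨⟨⟨fun s => ⟨_, hmem ((s:ℝ) * t)⟩, ?_⟩, ?_, ?_⟩⟩
    · refine Continuous.subtype_mk ?_ _
      fun_prop
    · ext1; simp
    · ext1; simp
  refine h1.trans ?_
  refine Unitary.joined _ _ ?_
  rw [Unitary.norm_sub_eq, Unitary.norm_sub_one_lt_two_iff (Subtype.property _)]
  intro hs
  apply ht
  have key : -Complex.exp (Complex.I * t) = Complex.exp (Complex.I * t) • (-1 : ℂ) := by simp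
  have h0 := Complex.exp_ne_zero (Complex.I * t)
  have e2 : (u : Matrix (Fin n) (Fin n) ℂ) = (Units.mk0 _ h0) • ((u * star (⟨_, hmem t⟩ : unitary (Matrix (Fin n) (Fin n) ℂ)) : unitary (Matrix (Fin n) (Fin n) ℂ)) : Matrix (Fin n) (Fin n) ℂ) := by
    have : Complex.exp (Complex.I * t) * star (Complex.exp (Complex.I * t))  = 1 := by
      rw [Complex.star_def, ← Complex.exp_conj, ← Complex.exp_add]; simp
    simp only [Units.smul_mk0, Submonoid.coe_mul, Unitary.coe_star, star_smul, star_one, mul_smul_comm, mul_one, smul_smul, this, one_smul]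
  rw [e2, key, spectrum.unit_smul_eq_smul]
  exact Set.smul_mem_smul_set hs

theorem core_topological {X : Type*} [TopologicalSpace X] [PreconnectedSpace X]
    (M : X → Matrix (Fin 3) (Fin 3) ℝ) (c : X → Fin 3 → ℝ) (hM : Continuous M) (hc : Continuous c)
    (p : Fin 3 → ℝ) (hp : ∀ u x, x ⬝ᵥ x = 1 → c u + M u *ᵥ x ≠ p)
    (u₀ : X) (x₀ : Fin 3 → ℝ) (hx₀ : x₀ ⬝ᵥ x₀ ≤ 1) (h₀ : c u₀ + M u₀ *ᵥ x₀ = p)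
    (u₁ : X) (h₁ : (M u₁).det = 0) : False := by
  set S : Set X := {u | ∃ x : Fin 3 → ℝ, x ⬝ᵥ x ≤ 1 ∧ c u + M u *ᵥ x = p} with hS
  set S' : Set X := {u | (M u).det ≠ 0 ∧
    ((M u).adjugate *ᵥ (p - c u)) ⬝ᵥ ((M u).adjugate *ᵥ (p - c u)) < (M u).det ^ 2} with hS'
  have hSS' : S = S' := by
    ext u
    constructor
    · rintro ⟨x, hx, hxp⟩
      by_cases hd : (M u).det = 0
      · exfalso
        obtain ⟨k, hk0, hk⟩ := Matrix.exists_mulVec_eq_zero_iff.2 hd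
        have ha : 0 < k ⬝ᵥ k := by
          have h1 : 0 ≤ k ⬝ᵥ k := Finset.sum_nonneg fun i _ => mul_self_nonneg _
          have h2 : k ⬝ᵥ k ≠ 0 := fun h => hk0 (dotProduct_self_eq_zero.1 h)
          exact lt_of_le_of_ne h1 (Ne.symm h2)
        set a := k ⬝ᵥ k with ha'
        set b := x ⬝ᵥ k with hb'
        set e := x ⬝ᵥ x with he'
        have hdisc : 0 ≤ b ^ 2 + a * (1 - e) := by nlinarith [sq_nonneg b]
        set r := Real.sqrt (b ^ 2 + a * (1 - e)) with hr
        have hr2 : r ^ 2 = b ^ 2 + a * (1 - e) := Real.sq_sqrt hdisc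
        set t := (-b + r) / a with ht
        have hta : t * a = -b + r := by rw [ht]; field_simp
        apply hp u (x + t • k)
        · have : (x + t • k) ⬝ᵥ (x + t • k) = e + 2 * t * b + t ^ 2 * a := by
            rw [add_dotProduct, dotProduct_add, dotProduct_add, smul_dotProduct, smul_dotProduct,
              dotProduct_smul, dotProduct_smul, dotProduct_comm k x]
            simp only [smul_eq_mul]
            rw [← ha', ← hb', ← he']; ring
          rw [this]
          have : a * (e + 2 * t * b + t ^ 2 * a) = a * 1 := by
            have : a * (e + 2 * t * b + t ^ 2 * a) = a * e + 2 * b * (t * a) + (t * a) ^ 2 := by ring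
            rw [this, hta]; nlinarith
          exact mul_left_cancel₀ ha.ne' this
        · rw [mulVec_add, mulVec_smul, hk, smul_zero, add_zero, hxp]
      · refine ⟨hd, ?_⟩
        have hy : (M u).adjugate *ᵥ (p - c u) = (M u).det • x := by
          rw [← hxp, add_sub_cancel_left, mulVec_mulVec, adjugate_mul, smul_mulVec, one_mulVec]
        rw [hy, smul_dotProduct, dotProduct_smul]
        have hlt : x ⬝ᵥ x < 1 := lt_of_le_of_ne hx fun h => hp u x h hxp
        have : 0 < (M u).det ^ 2 := by positivity
        simp only [smul_eq_mul]
        nlinarith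
    · rintro ⟨hd, hy⟩
      refine ⟨(M u).det⁻¹ • ((M u).adjugate *ᵥ (p - c u)), ?_, ?_⟩
      · rw [smul_dotProduct, dotProduct_smul]
        simp only [smul_eq_mul]
        have : 0 < (M u).det ^ 2 := by positivity
        rw [← mul_assoc, ← sq, inv_pow, inv_mul_le_iff₀ this]
        linarith
      · rw [mulVec_smul, mulVec_mulVec, mul_adjugate, smul_mulVec, one_mulVec, smul_smul,
          inv_mul_cancel₀ hd, one_smul]
        abel
  have hopen : IsOpen S' := by
    have hy : Continuous fun u => (M u).adjugate *ᵥ (p - c u) :=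
      (hM.matrix_adjugate).matrix_mulVec (continuous_const.sub hc)
    refine IsOpen.inter ?_ ?_
    · exact isOpen_ne_fun hM.matrix_det continuous_const
    · exact isOpen_lt (hy.dotProduct hy) (hM.matrix_det.pow 2)
  have hclosed : IsClosed S := by
    let K : Set (Fin 3 → ℝ) := {x | x ⬝ᵥ x ≤ 1}
    have hKc : IsClosed K := isClosed_le (continuous_id.dotProduct continuous_id) continuous_const
    have hK : IsCompact K := by
      refine IsCompact.of_isClosed_subset (isCompact_Icc (a := fun _ => (-1:ℝ)) (b := fun _ => 1))
        hKc ?_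
      intro x hx
      have hx' : x ⬝ᵥ x ≤ 1 := hx
      have h : ∀ i, x i ^ 2 ≤ 1 := fun i => by
        refine le_trans ?_ hx'
        rw [sq]
        exact Finset.single_le_sum (f := fun i => x i * x i) (fun j _ => mul_self_nonneg _)
          (Finset.mem_univ i)
      exact ⟨fun i => (abs_le.1 ((sq_le_one_iff_abs_le_one _).1 (h i))).1,
        fun i => (abs_le.1 ((sq_le_one_iff_abs_le_one _).1 (h i))).2⟩
    have : CompactSpace K := isCompact_iff_compactSpace.1 hK
    have hcl : IsClosed {q : X × K | c q.1 + M q.1 *ᵥ (q.2 : Fin 3 → ℝ) = p} := by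
      refine isClosed_eq ?_ continuous_const
      exact (hc.comp continuous_fst).add ((hM.comp continuous_fst).matrix_mulVec
        (continuous_subtype_val.comp continuous_snd))
    have := isClosedMap_fst_of_compactSpace _ hcl
    convert this using 1
    ext u
    constructor
    · rintro ⟨x, hx, h⟩
      exact ⟨(u, ⟨x, hx⟩), h, rfl⟩
    · rintro ⟨⟨v, x, hx⟩, h, rfl⟩
      exact ⟨x, hx, h⟩
  have hclopen : IsClopen S := ⟨hclosed, hSS' ▸ hopen⟩
  have huniv := hclopen.eq_univ ⟨u₀, x₀, hx₀, h₀⟩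
  have : u₁ ∈ S' := by rw [← hSS', huniv]; trivial
  exact this.1 h₁

/-- The traceless Hermitian matrix supported on the leading block. -/
noncomputable def Smat (k : ℕ) : (Fin 3 → ℝ) →ₗ[ℝ] Matrix (Fin (k + 3)) (Fin (k + 3)) ℂ where
  toFun x := Matrix.of fun i j =>
    if i = 0 ∧ j = 0 then (x 0 : ℂ)
    else if i = 0 ∧ j = 1 then (x 1 : ℂ) + Complex.I * x 2
    else if i = 1 ∧ j = 0 then (x 1 : ℂ) - Complex.I * x 2
    else if i = 1 ∧ j = 1 then -(x 0 : ℂ)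
    else 0
  map_add' x y := by
    ext i j
    simp only [of_apply, Matrix.add_apply, Pi.add_apply, Complex.ofReal_add]
    split_ifs <;> ring
  map_smul' r x := by
    ext i j
    simp only [of_apply, Matrix.smul_apply, Pi.smul_apply, smul_eq_mul, Complex.ofReal_mul,
      RingHom.id_apply, Complex.real_smul]
    split_ifs <;> ring

noncomputable def Bmat (k : ℕ) (d : Fin (k + 3) → ℝ) : Matrix (Fin (k + 3)) (Fin (k + 3)) ℂ :=
  Matrix.diagonal fun j => if j = 0 ∨ j = 1 then (((d 0 + d 1) / 2 : ℝ) : ℂ) else (d j : ℂ)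

theorem fin_cases3 {k : ℕ} (i : Fin (k + 3)) : i = 0 ∨ i = 1 ∨ ∃ j : Fin (k + 1), i = j.succ.succ := by
  induction i using Fin.cases with
  | zero => exact Or.inl rfl
  | succ i =>
    induction i using Fin.cases with
    | zero => exact Or.inr (Or.inl rfl)
    | succ j => exact Or.inr (Or.inr ⟨j, rfl⟩)

theorem ss_ne_one {k : ℕ} (j : Fin (k + 1)) : (j.succ.succ : Fin (k + 3)) ≠ 1 :=
  fun h => Fin.succ_ne_zero j (Fin.succ_injective _ h)
theorem one_ne_ss {k : ℕ} (j : Fin (k + 1)) : 1 ≠ (j.succ.succ : Fin (k + 3)) :=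
  (ss_ne_one j).symm
theorem zero_ne_ss {k : ℕ} (j : Fin (k + 1)) : 0 ≠ (j.succ.succ : Fin (k + 3)) :=
  (Fin.succ_ne_zero _).symm

theorem two_eq_ss (k : ℕ) : (2 : Fin (k + 3)) = Fin.succ (Fin.succ 0) := rfl

theorem Tmat_00 (k : ℕ) (θ φ : ℝ) : Tmat (k + 3) θ φ 0 0 = (Real.cos θ : ℂ) := by simp [Tmat]
theorem Tmat_01 (k : ℕ) (θ φ : ℝ) :
    Tmat (k + 3) θ φ 0 1 = (Real.sin θ : ℂ) * Complex.exp (Complex.I * φ) := by simp [Tmat]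
theorem Tmat_10 (k : ℕ) (θ φ : ℝ) : Tmat (k + 3) θ φ 1 0 = -(Real.sin θ : ℂ) := by simp [Tmat]
theorem Tmat_11 (k : ℕ) (θ φ : ℝ) :
    Tmat (k + 3) θ φ 1 1 = (Real.cos θ : ℂ) * Complex.exp (Complex.I * φ) := by simp [Tmat]
theorem Tmat_0s (k : ℕ) (θ φ : ℝ) (j : Fin (k + 1)) : Tmat (k + 3) θ φ 0 j.succ.succ = 0 := by
  simp [Tmat, zero_ne_ss]
theorem Tmat_1s (k : ℕ) (θ φ : ℝ) (j : Fin (k + 1)) : Tmat (k + 3) θ φ 1 j.succ.succ = 0 := by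
  simp [Tmat, one_ne_ss]
theorem Tmat_s0 (k : ℕ) (θ φ : ℝ) (j : Fin (k + 1)) : Tmat (k + 3) θ φ j.succ.succ 0 = 0 := by
  simp [Tmat]
theorem Tmat_s1 (k : ℕ) (θ φ : ℝ) (j : Fin (k + 1)) : Tmat (k + 3) θ φ j.succ.succ 1 = 0 := by
  simp [Tmat, ss_ne_one]
theorem Tmat_ss (k : ℕ) (θ φ : ℝ) (i j : Fin (k + 1)) :
    Tmat (k + 3) θ φ i.succ.succ j.succ.succ = if i = j then 1 else 0 := by
  simp [Tmat]

theorem Tconj (k : ℕ) (d : Fin (k + 3) → ℝ) (θ φ : ℝ) :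
    (Tmat (k + 3) θ φ)ᴴ * Matrix.diagonal (fun j => (d j : ℂ)) * Tmat (k + 3) θ φ =
      Bmat k d + ((d 0 - d 1) / 2 : ℝ) • Smat k ![Real.cos (2 * θ),
        Real.sin (2 * θ) * Real.cos φ, Real.sin (2 * θ) * Real.sin φ] := by
  have hS2 : (Complex.exp (Complex.I * φ)) = Complex.cos φ + Complex.I * Complex.sin φ := by
    rw [mul_comm, Complex.exp_mul_I]; ring
  have hcc : ∀ t : ℝ, (starRingEnd ℂ) (Complex.cos t) = Complex.cos t := fun t => by
    rw [← Complex.cos_conj, Complex.conj_ofReal]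
  have hss : ∀ t : ℝ, (starRingEnd ℂ) (Complex.sin t) = Complex.sin t := fun t => by
    rw [← Complex.sin_conj, Complex.conj_ofReal]
  have hI : Complex.I ^ 2 = -1 := Complex.I_sq
  have h1 : Complex.sin φ ^ 2 + Complex.cos φ ^ 2 = 1 := Complex.sin_sq_add_cos_sq _
  have h2 : Complex.sin θ ^ 2 + Complex.cos θ ^ 2 = 1 := Complex.sin_sq_add_cos_sq _
  ext i j
  rw [Matrix.mul_apply]
  simp only [Matrix.mul_diagonal, Matrix.conjTranspose_apply]
  rw [Fin.sum_univ_succ, Fin.sum_univ_succ]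
  have e1 : Fin.succ (0 : Fin (k + 2)) = 1 := rfl
  rw [e1]
  rcases fin_cases3 i with rfl | rfl | ⟨i, rfl⟩ <;> rcases fin_cases3 j with rfl | rfl | ⟨j, rfl⟩ <;>
    simp [Tmat_00, Tmat_01, Tmat_10, Tmat_11, Tmat_0s, Tmat_1s, Tmat_s0, Tmat_s1, Tmat_ss,
      Bmat, Smat, ss_ne_one, one_ne_ss, zero_ne_ss, Matrix.diagonal_apply, hcc, hss, hS2,
      Complex.cos_two_mul, Complex.sin_two_mul]
  · linear_combination (d 1 : ℂ) * h2
  · ring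
  · ring
  · linear_combination (Complex.sin θ ^ 2 * d 0 + Complex.cos θ ^ 2 * d 1) *
      (h1 - Complex.sin φ ^ 2 * hI) + (d 0 : ℂ) * h2
  · by_cases h : i = j
    · subst h; simp
    · simp [h, Ne.symm h]

theorem Tmat_unitary (k : ℕ) (θ φ : ℝ) :
    Tmat (k + 3) θ φ ∈ Matrix.unitaryGroup (Fin (k + 3)) ℂ := by
  rw [Matrix.mem_unitaryGroup_iff']
  have h := Tconj k (fun _ => 1) θ φ
  have hB : Bmat k (fun _ => 1) = 1 := by
    rw [Bmat, ← Matrix.diagonal_one]; congr 1; ext j; simp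
  rw [star_eq_conjTranspose]
  simpa [hB] using h

theorem Smat_hermitian (k : ℕ) (x : Fin 3 → ℝ) : (Smat k x)ᴴ = Smat k x := by
  ext i j
  rw [Matrix.conjTranspose_apply]
  rcases fin_cases3 i with rfl | rfl | ⟨i, rfl⟩ <;> rcases fin_cases3 j with rfl | rfl | ⟨j, rfl⟩ <;>
    simp [Smat, ss_ne_one, one_ne_ss, zero_ne_ss, sub_eq_add_neg]

theorem exists_hermitian_rep (n : ℕ) (f : Matrix (Fin n) (Fin n) ℂ →ₗ[ℝ] ℝ) :
    ∃ H : Matrix (Fin n) (Fin n) ℂ, H.IsHermitian ∧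
      ∀ X : Matrix (Fin n) (Fin n) ℂ, Xᴴ = X → f X = (trace (H * X)).re := by
  let F : Matrix (Fin n) (Fin n) ℂ →ₗ[ℂ] ℂ := Module.Dual.extendRCLike (𝕜 := ℂ) f
  have hF : ∀ X, f X = (F X).re := fun X => (Module.Dual.re_extendRCLike_apply (𝕜 := ℂ) f X).symm
  let K : Matrix (Fin n) (Fin n) ℂ := Matrix.of fun b a => F (Matrix.single a b 1)
  have hK : ∀ X, F X = trace (K * X) := by
    intro X
    conv_lhs => rw [Matrix.matrix_eq_sum_single X]
    simp only [map_sum, trace, Matrix.diag, Matrix.mul_apply]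
    rw [Finset.sum_comm]
    refine Finset.sum_congr rfl fun b _ => Finset.sum_congr rfl fun a _ => ?_
    have : Matrix.single a b (X a b) = X a b • Matrix.single a b (1 : ℂ) := by simp
    rw [this, map_smul, smul_eq_mul, mul_comm]
    rfl
  refine ⟨(1 / 2 : ℂ) • (K + Kᴴ), ?_, ?_⟩
  · rw [Matrix.IsHermitian, conjTranspose_smul, conjTranspose_add, conjTranspose_conjTranspose,
      add_comm]
    simp
  · intro X hX
    have h1 : trace (Kᴴ * X) = star (trace (K * X)) := by
      rw [← trace_conjTranspose, conjTranspose_mul, hX, trace_mul_comm]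
    rw [hF, hK, smul_mul_assoc, add_mul, trace_smul, trace_add, h1]
    simp
    ring

theorem submatrix_unitary {n : ℕ} {W : Matrix (Fin n) (Fin n) ℂ}
    (hW : W ∈ Matrix.unitaryGroup (Fin n) ℂ) (σ : Equiv.Perm (Fin n)) :
    W.submatrix σ id ∈ Matrix.unitaryGroup (Fin n) ℂ := by
  rw [Matrix.mem_unitaryGroup_iff, star_eq_conjTranspose] at *
  rw [conjTranspose_submatrix, ← submatrix_mul W Wᴴ σ id σ Function.bijective_id, hW]
  simp

theorem submatrix_conj {n : ℕ} (W H : Matrix (Fin n) (Fin n) ℂ) (σ : Equiv.Perm (Fin n)) :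
    W.submatrix σ id * H * (W.submatrix σ id)ᴴ = (W * H * Wᴴ).submatrix σ σ := by
  ext i j
  simp [Matrix.mul_apply]

theorem exists_diag (k : ℕ) (H : Matrix (Fin (k + 3)) (Fin (k + 3)) ℂ) (hH : H.IsHermitian) :
    ∃ W ∈ Matrix.unitaryGroup (Fin (k + 3)) ℂ, ∃ μ : Fin (k + 3) → ℝ,
      W * H * Wᴴ = Matrix.diagonal (fun j => (μ j : ℂ)) ∧ μ 0 ≤ μ 2 ∧ μ 2 ≤ μ 1 := by
  let V := hH.eigenvectorUnitary
  have hV : (star V : Matrix (Fin (k + 3)) (Fin (k + 3)) ℂ) * H * V =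
      Matrix.diagonal (fun j => (hH.eigenvalues j : ℂ)) := by
    have := hH.conjStarAlgAut_star_eigenvectorUnitary
    rw [Unitary.conjStarAlgAut_apply] at this
    simp only [Unitary.coe_star, star_star] at this
    exact this
  let lam := hH.eigenvalues
  let σ := Tuple.sort lam
  have hmono : Monotone (lam ∘ σ) := Tuple.monotone_sort lam
  let τ : Equiv.Perm (Fin (k + 3)) := (Equiv.swap 1 2).trans σ
  refine ⟨(star V : Matrix (Fin (k + 3)) (Fin (k + 3)) ℂ).submatrix τ id,
    submatrix_unitary (star V).2 τ, lam ∘ τ, ?_, ?_, ?_⟩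
  · rw [submatrix_conj]
    have : ((star V : Matrix (Fin (k + 3)) (Fin (k + 3)) ℂ))ᴴ = V := by
      rw [star_eq_conjTranspose, conjTranspose_conjTranspose]
    rw [this, hV, submatrix_diagonal_equiv]
    rfl
  · have h0 : τ 0 = σ 0 := by
      simp only [τ, Equiv.trans_apply]; rw [Equiv.swap_apply_of_ne_of_ne (by simp) (by rw [two_eq_ss]; exact zero_ne_ss _)]
    have h2 : τ 2 = σ 1 := by simp [τ]
    simp only [Function.comp, h0, h2]
    exact hmono (Fin.zero_le 1)
  · have h1 : τ 1 = σ 2 := by simp [τ]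
    have h2 : τ 2 = σ 1 := by simp [τ]
    simp only [Function.comp, h1, h2]
    exact hmono (by rw [two_eq_ss]; exact Fin.succ_le_succ_iff.2 (Fin.zero_le _))

theorem exists_degenerate (k : ℕ) (f : Matrix (Fin (k + 3)) (Fin (k + 3)) ℂ →ₗ[ℝ] ℝ) :
    ∃ U ∈ Matrix.unitaryGroup (Fin (k + 3)) ℂ, ∀ x, f (Uᴴ * Smat k x * U) = 0 := by
  obtain ⟨H, hH, hf⟩ := exists_hermitian_rep _ f
  obtain ⟨W, hW, μ, hWμ, h02, h21⟩ := exists_diag k H hH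
  obtain ⟨θ, hθ⟩ : ∃ θ : ℝ, Real.cos θ ^ 2 * μ 0 + Real.sin θ ^ 2 * μ 1 = μ 2 := by
    have hc : ContinuousOn (fun θ : ℝ => Real.cos θ ^ 2 * μ 0 + Real.sin θ ^ 2 * μ 1)
      (Set.Icc 0 (Real.pi / 2)) := by fun_prop
    obtain ⟨θ, -, h⟩ := intermediate_value_Icc (by positivity) hc
      (show μ 2 ∈ Set.Icc _ _ by simp [h02, h21])
    exact ⟨θ, h⟩
  let T := Tmat (k + 3) θ 0
  let σ : Equiv.Perm (Fin (k + 3)) := Equiv.swap 1 2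
  have hT := Tmat_unitary k θ 0
  refine ⟨(T * W).submatrix σ id, submatrix_unitary (mul_mem hT hW) σ, fun x => ?_⟩
  set U := (T * W).submatrix σ id with hUdef
  have hQ : U * H * Uᴴ = (T * Matrix.diagonal (fun j => (μ j : ℂ)) * Tᴴ).submatrix σ σ := by
    rw [hUdef, submatrix_conj, conjTranspose_mul, ← hWμ]
    simp only [Matrix.mul_assoc]
  set Q := U * H * Uᴴ with hQdef
  rw [hf _ (by simp only [conjTranspose_mul, conjTranspose_conjTranspose, Smat_hermitian, Matrix.mul_assoc])]
  have htr : trace (H * (Uᴴ * Smat k x * U)) = trace (Q * Smat k x) := by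
    rw [hQdef, ← Matrix.mul_assoc, ← Matrix.mul_assoc, trace_mul_comm, ← Matrix.mul_assoc, ← Matrix.mul_assoc]
  have s0 : σ 0 = 0 := by
    simp only [σ]; rw [Equiv.swap_apply_of_ne_of_ne (by simp) (by rw [two_eq_ss]; exact zero_ne_ss _)]
  have s1 : σ 1 = Fin.succ (Fin.succ 0) := by simp only [σ, Equiv.swap_apply_left]; rfl
  have q00 : Q 0 0 = μ 2 := by
    rw [hQ, submatrix_apply, s0, Matrix.mul_apply]
    simp only [Matrix.mul_diagonal, Matrix.conjTranspose_apply]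
    rw [Fin.sum_univ_succ, Fin.sum_univ_succ]
    have e1 : Fin.succ (0 : Fin (k + 2)) = 1 := rfl
    rw [e1, ← hθ]
    simp [T, Tmat_00, Tmat_01, Tmat_0s, ← Complex.cos_conj, ← Complex.sin_conj]
    ring
  have q01 : Q 0 1 = 0 := by
    rw [hQ, submatrix_apply, s0, s1, Matrix.mul_apply]
    simp only [Matrix.mul_diagonal, Matrix.conjTranspose_apply]
    rw [Fin.sum_univ_succ, Fin.sum_univ_succ]
    have e1 : Fin.succ (0 : Fin (k + 2)) = 1 := rfl
    rw [e1]
    simp only [T, Tmat_0s, Tmat_s0, Tmat_s1, star_zero, mul_zero, zero_mul, add_zero,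
      Finset.sum_const_zero]
  have q10 : Q 1 0 = 0 := by
    rw [hQ, submatrix_apply, s0, s1, Matrix.mul_apply]
    simp only [Matrix.mul_diagonal, Matrix.conjTranspose_apply]
    rw [Fin.sum_univ_succ, Fin.sum_univ_succ]
    have e1 : Fin.succ (0 : Fin (k + 2)) = 1 := rfl
    rw [e1]
    simp only [T, Tmat_0s, Tmat_s0, Tmat_s1, star_zero, mul_zero, zero_mul, add_zero,
      Finset.sum_const_zero]
  have q11 : Q 1 1 = μ 2 := by
    rw [hQ, submatrix_apply, s1, Matrix.mul_apply]
    simp only [Matrix.mul_diagonal, Matrix.conjTranspose_apply]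
    rw [Fin.sum_univ_succ, Fin.sum_univ_succ]
    have e1 : Fin.succ (0 : Fin (k + 2)) = 1 := rfl
    rw [e1]
    simp only [T, Tmat_ss, Tmat_s0, Tmat_s1, star_zero, mul_zero, zero_mul, zero_add, ite_mul,
      one_mul, Finset.sum_ite_eq, Finset.mem_univ, if_true, star_one, mul_one]
    rfl
  rw [htr]
  have : trace (Q * Smat k x) = 0 := by
    simp only [trace, Matrix.diag, Matrix.mul_apply]
    rw [Fin.sum_univ_succ, Fin.sum_univ_succ]
    simp_rw [Fin.sum_univ_succ (n := k + 2), Fin.sum_univ_succ (n := k + 1)]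
    have e1 : Fin.succ (0 : Fin (k + 2)) = 1 := rfl
    rw [e1, q00, q01, q10, q11]
    simp [Smat, ss_ne_one, one_ne_ss, zero_ne_ss]
  rw [this]; rfl

theorem sphere_param (x : Fin 3 → ℝ) (hx : x ⬝ᵥ x = 1) : ∃ θ φ : ℝ,
    x = ![Real.cos (2 * θ), Real.sin (2 * θ) * Real.cos φ, Real.sin (2 * θ) * Real.sin φ] := by
  simp only [dotProduct, Fin.sum_univ_three] at hx
  refine ⟨Real.arccos (x 0) / 2, Complex.arg ⟨x 1, x 2⟩, ?_⟩
  have h1 : 2 * (Real.arccos (x 0) / 2) = Real.arccos (x 0) := by ring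
  have hn : ‖(⟨x 1, x 2⟩ : ℂ)‖ = Real.sqrt (1 - x 0 ^ 2) := by
    rw [Complex.norm_def, Complex.normSq_mk]; congr 1; linarith
  rw [h1, Real.cos_arccos (by nlinarith [mul_self_nonneg (x 1), mul_self_nonneg (x 2)])
    (by nlinarith [mul_self_nonneg (x 1), mul_self_nonneg (x 2)]), Real.sin_arccos, ← hn,
    Complex.norm_mul_cos_arg, Complex.norm_mul_sin_arg]
  ext i; fin_cases i <;> rfl

theorem convex_dotBall : Convex ℝ {x : Fin 3 → ℝ | x ⬝ᵥ x ≤ 1} := by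
  intro x hx y hy a b ha hb hab
  simp only [Set.mem_setOf_eq, dotProduct, Fin.sum_univ_three, Pi.add_apply, Pi.smul_apply,
    smul_eq_mul] at *
  have hb' : b = 1 - a := by linarith
  subst hb'
  nlinarith [mul_nonneg (mul_nonneg ha hb) (add_nonneg (add_nonneg (sq_nonneg (x 0 - y 0))
    (sq_nonneg (x 1 - y 1))) (sq_nonneg (x 2 - y 2))), mul_le_mul_of_nonneg_left hx ha,
    mul_le_mul_of_nonneg_left hy hb]

/-- For `n > 2`, a tuple of real diagonal matrices `D` and a linear `L : H_n^m → ℝ³`,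
the convex hull of `E_L(D,U)` is contained in `W_L(D)` for every unitary `U`. -/
theorem stmt17 {n m : ℕ} (hn : 2 < n) (d : Fin m → Fin n → ℝ)
    (L : (Fin m → Matrix (Fin n) (Fin n) ℂ) →ₗ[ℝ] (Fin 3 → ℝ))
    (U : Matrix (Fin n) (Fin n) ℂ) (hU : U ∈ Matrix.unitaryGroup (Fin n) ℂ) :
    convexHull ℝ (Eset L (fun i => Matrix.diagonal fun j => (d i j : ℂ)) U) ⊆
      LNumericalRange L (fun i => Matrix.diagonal fun j => (d i j : ℂ)) := by
  obtain ⟨k, rfl⟩ : ∃ k, n = k + 3 := ⟨n - 3, by omega⟩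
  -- the linear part and the affine part of the parametrization of the ellipsoid
  let G : Matrix (Fin (k + 3)) (Fin (k + 3)) ℂ →ₗ[ℝ] (Fin 3 → ℝ) :=
    L ∘ₗ LinearMap.pi fun i => ((d i 0 - d i 1) / 2 : ℝ) • LinearMap.id
  let c : Matrix (Fin (k + 3)) (Fin (k + 3)) ℂ → (Fin 3 → ℝ) :=
    fun V => L fun i => Vᴴ * Bmat k (d i) * V
  let Mlin : Matrix (Fin (k + 3)) (Fin (k + 3)) ℂ → ((Fin 3 → ℝ) →ₗ[ℝ] (Fin 3 → ℝ)) :=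
    fun V => { toFun := fun x => G (Vᴴ * Smat k x * V)
               map_add' := fun x y => by rw [map_add, Matrix.mul_add, Matrix.add_mul, map_add]
               map_smul' := fun r x => by
                rw [map_smul, Matrix.mul_smul, Matrix.smul_mul, map_smul]; rfl }
  let M := fun V => LinearMap.toMatrix' (Mlin V)
  have hMx : ∀ V x, M V *ᵥ x = G (Vᴴ * Smat k x * V) := fun V x => by
    simp only [M, LinearMap.toMatrix'_mulVec]; rfl
  have hpar : ∀ V θ φ, (L fun i => Vᴴ * (Tmat (k + 3) θ φ)ᴴ *
      (Matrix.diagonal fun j => (d i j : ℂ)) * Tmat (k + 3) θ φ * V) =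
      c V + M V *ᵥ ![Real.cos (2 * θ), Real.sin (2 * θ) * Real.cos φ,
        Real.sin (2 * θ) * Real.sin φ] := by
    intro V θ φ
    rw [hMx]
    simp only [c, G, LinearMap.comp_apply]
    rw [← map_add]
    congr 1
    ext1 i
    have h := Tconj k (d i) θ φ
    have h2 : Vᴴ * (Tmat (k + 3) θ φ)ᴴ * (Matrix.diagonal fun j => (d i j : ℂ)) *
        Tmat (k + 3) θ φ * V = Vᴴ * ((Tmat (k + 3) θ φ)ᴴ * (Matrix.diagonal fun j => (d i j : ℂ)) *
        Tmat (k + 3) θ φ) * V := by simp only [Matrix.mul_assoc]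
    rw [h2, h, Matrix.mul_add, Matrix.add_mul, Matrix.mul_smul, Matrix.smul_mul]
    rfl
  intro p hp
  -- the point `p` lies in the affine image of the ball
  obtain ⟨x₀, hx₀, hp₀⟩ : ∃ x : Fin 3 → ℝ, x ⬝ᵥ x ≤ 1 ∧ c U + M U *ᵥ x = p := by
    have hconv : Convex ℝ ((fun x => c U + M U *ᵥ x) '' {x : Fin 3 → ℝ | x ⬝ᵥ x ≤ 1}) := by
      have h := (convex_dotBall.linear_image (M U).mulVecLin).translate (c U)
      rw [Set.image_image] at h
      exact h
    refine convexHull_min ?_ hconv hp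
    rintro y ⟨θ, -, φ, -, rfl⟩
    refine ⟨_, ?_, (hpar U θ φ).symm⟩
    simp only [Set.mem_setOf_eq, dotProduct, Fin.sum_univ_three]
    simp
    have h1 := Real.sin_sq_add_cos_sq (2 * θ)
    have h2 := Real.sin_sq_add_cos_sq φ
    apply le_of_eq
    linear_combination h1 + Real.sin (2 * θ) ^ 2 * h2
  by_contra hnot
  haveI := unitary_preconn (k + 3)
  obtain ⟨U₁, hU₁, hdeg⟩ := exists_degenerate k (LinearMap.proj 0 ∘ₗ G)
  have hGc : Continuous G := G.continuous_of_finiteDimensional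
  have hLc : Continuous L := L.continuous_of_finiteDimensional
  refine core_topological (X := Matrix.unitaryGroup (Fin (k + 3)) ℂ) (fun V => M V) (fun V => c V)
    ?_ ?_ p ?_ ⟨U, hU⟩ x₀ hx₀ hp₀ ⟨U₁, hU₁⟩ ?_
  · refine continuous_matrix fun i j => ?_
    have : ∀ V, M V i j = G (Vᴴ * Smat k (Pi.single j 1) * V) i := fun V => by
      rw [← hMx, mulVec_single_one]; rfl
    simp only [this]
    refine (continuous_apply i).comp (hGc.comp ?_)
    exact (continuous_subtype_val.matrix_conjTranspose.matrix_mul continuous_const).matrix_mul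
      continuous_subtype_val
  · refine hLc.comp (continuous_pi fun i => ?_)
    exact (continuous_subtype_val.matrix_conjTranspose.matrix_mul continuous_const).matrix_mul
      continuous_subtype_val
  · rintro ⟨V, hV⟩ x hx rfl
    obtain ⟨θ, φ, rfl⟩ := sphere_param x hx
    apply hnot
    refine ⟨Tmat (k + 3) θ φ * V, mul_mem (Tmat_unitary k θ φ) hV, ?_⟩
    refine (hpar V θ φ).symm.trans (congrArg L (funext fun i => ?_))
    rw [conjTranspose_mul]
    simp only [Matrix.mul_assoc]
  · refine Matrix.det_eq_zero_of_row_eq_zero 0 fun j => ?_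
    have : M U₁ 0 j = G (U₁ᴴ * Smat k (Pi.single j 1) * U₁) 0 := by
      rw [← hMx, mulVec_single_one]; rfl
    rw [this]
    exact hdeg _
end
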